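/- arXiv:2301.12849 — 2 statements merged into one kernel-verified Lean document; each statement's English description precedes it below -/
import Mathlib

section
/- Let p be a prime and let G be a finite non-cyclic p-group; if p = 2, assume moreover that G is not of maximal class (i.e., if |G| = 2ⁿ then the nilpotency class of G is not n − 1). Then the number of subgroups of G of order p is congruent to 1 + p modulo p². -/
theorem Set.dvd_ncard_of_dvd_ncard_fiber {α β : Type*} [Finite α] {m : ℕ} (T : Set α) (f : α → β)
    (h : ∀ a ∈ T, m ∣ (T ∩ {b | f b = f a}).ncard) : m ∣ T.ncard := by
  classical
  have := Fintype.ofFinite α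
  rw [Set.ncard_eq_toFinset_card', Finset.card_eq_sum_card_image f]
  refine Finset.dvd_sum fun b hb => ?_
  obtain ⟨a, ha, rfl⟩ := Finset.mem_image.1 hb
  have key := h a (Set.mem_toFinset.1 ha)
  rw [Set.ncard_eq_toFinset_card'] at key
  rwa [show (T ∩ {b | f b = f a}).toFinset = {x ∈ T.toFinset | f x = f a} by ext x; simp] at key

section

open scoped commutatorElement

variable {G : Type*} [Group G]

theorem Subgroup.normal_zpowers_of_mem_center {z : G} (hz : z ∈ Subgroup.center G) :
    (Subgroup.zpowers z).Normal :=
  ⟨fun x hx g => by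
    rwa [Subgroup.mem_center_iff.1 (Subgroup.zpowers_le.2 hz hx) g, mul_inv_cancel_right]⟩

variable [Finite G]

theorem Subgroup.card_dvd_ncard_of_mul_mem (W : Subgroup G) (T : Set G)
    (h : ∀ x ∈ T, ∀ w ∈ W, x * w ∈ T) : Nat.card W ∣ T.ncard := by
  refine Set.dvd_ncard_of_dvd_ncard_fiber T (QuotientGroup.mk : G → G ⧸ W) fun a ha => ?_
  have : T ∩ {b | (QuotientGroup.mk b : G ⧸ W) = QuotientGroup.mk a} =
      (fun w => a * w) '' (W : Set G) := by
    ext b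
    simp only [Set.mem_inter_iff, Set.mem_ofPred_eq, Set.mem_image, SetLike.mem_coe]
    constructor
    · rintro ⟨-, hb⟩
      exact ⟨a⁻¹ * b, QuotientGroup.eq.1 hb.symm, by group⟩
    · rintro ⟨w, hw, rfl⟩
      exact ⟨h a ha w hw, by rw [eq_comm, QuotientGroup.eq]; simpa using hw⟩
  rw [this, Set.ncard_image_of_injective _ (mul_right_injective a)]
  exact (Nat.card_coe_set_eq (W : Set G)).dvd

theorem IsPGroup.ncard_conjClass {p : ℕ} [Fact p.Prime] (hG : IsPGroup p G) (x : G) :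
    ∃ n, {y | IsConj x y}.ncard = p ^ n := by
  obtain ⟨n, hn⟩ := (hG.of_equiv (ConjAct.toConjAct (G := G))).card_orbit x
  refine ⟨n, ?_⟩
  rw [← hn, ← Nat.card_coe_set_eq]
  congr 2
  ext y
  rw [ConjAct.mem_orbit_conjAct, Set.mem_ofPred_eq, isConj_comm]

theorem mul_pow_of_commutator_central {M : Type*} [Monoid M] {x y c : M} (h : y * x = x * y * c)
    (hx : Commute c x) (hy : Commute c y) (n : ℕ) :
    (x * y) ^ n = x ^ n * y ^ n * c ^ n.choose 2 := by
  have key : ∀ n : ℕ, y ^ n * x = x * y ^ n * c ^ n := by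
    intro n
    induction n with
    | zero => simp
    | succ n ih =>
      calc y ^ (n + 1) * x = y ^ n * (y * x) := by rw [pow_succ, mul_assoc]
        _ = (y ^ n * x) * (y * c) := by rw [h]; simp only [mul_assoc]
        _ = x * y ^ n * (c ^ n * y) * c := by rw [ih]; simp only [mul_assoc]
        _ = _ := by rw [(hy.pow_left n).eq, pow_succ, pow_succ]; simp only [mul_assoc]
  induction n with
  | zero => simp
  | succ n ih =>
    have e : (n + 1).choose 2 = n + n.choose 2 := by
      rw [Nat.choose_succ_succ' n 1, Nat.choose_one_right]
    calc (x * y) ^ (n + 1) = x ^ n * y ^ n * (c ^ n.choose 2 * (x * y)) := by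
          rw [pow_succ, ih]; simp only [mul_assoc]
      _ = x ^ n * (y ^ n * x) * y * c ^ n.choose 2 := by
          rw [((hx.mul_right hy).pow_left _).eq]; simp only [mul_assoc]
      _ = x ^ n * x * y ^ n * (c ^ n * y) * c ^ n.choose 2 := by
          rw [key]; simp only [mul_assoc]
      _ = _ := by
          rw [(hy.pow_left n).eq, e, pow_add c, pow_succ x n, pow_succ y n]; simp only [mul_assoc]

theorem IsPGroup.exists_central_orderOf_eq_prime {p : ℕ} [Fact p.Prime] (hG : IsPGroup p G)
    (N : Subgroup G) [N.Normal] (hN : N ≠ ⊥) :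
    ∃ u ∈ N, u ∈ Subgroup.center G ∧ orderOf u = p := by
  have hfix : ∃ v ∈ N, v ∈ Subgroup.center G ∧ v ≠ 1 := by
    have hd : p ∣ Nat.card N := by
      rcases (hG.to_subgroup N).card_eq_or_dvd with h | h
      · exact absurd (Subgroup.card_eq_one.1 h) hN
      · exact h
    obtain ⟨v, hv, hne⟩ := (hG.of_equiv
      (ConjAct.toConjAct (G := G))).exists_fixed_point_of_prime_dvd_card_of_fixed_point N hd
      (a := 1) (fun g => smul_one g)
    refine ⟨v, v.2, Subgroup.mem_center_iff.2 fun g => ?_, fun h => hne (Subtype.ext h.symm)⟩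
    have := congrArg Subtype.val (hv (ConjAct.toConjAct g))
    rw [ConjAct.Subgroup.val_conj_smul, ConjAct.smul_def] at this
    simpa [mul_inv_eq_iff_eq_mul] using this
  obtain ⟨v, hvN, hvc, hv⟩ := hfix
  have hd := hG.dvd_orderOf hv
  refine ⟨v ^ (orderOf v / p), pow_mem hvN _, pow_mem hvc _, ?_⟩
  exact orderOf_pow_orderOf_div (orderOf_pos v).ne' hd

/-- A normal subgroup properly containing a normal subgroup `Z` contains an element of order `p`
modulo `Z` which is central modulo `Z`. -/
theorem IsPGroup.exists_central_mod {p : ℕ} [Fact p.Prime] (hG : IsPGroup p G)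
    (Z N : Subgroup G) [Z.Normal] [N.Normal] (hN : ¬ N ≤ Z) :
    ∃ u ∈ N, u ∉ Z ∧ u ^ p ∈ Z ∧ ∀ g : G, ⁅g, u⁆ ∈ Z := by
  have : (N.map (QuotientGroup.mk' Z)).Normal :=
    Subgroup.Normal.map ‹_› _ (QuotientGroup.mk'_surjective Z)
  obtain ⟨v, hvN, hvc, hv⟩ := (hG.to_quotient Z).exists_central_orderOf_eq_prime
    (N.map (QuotientGroup.mk' Z)) (by
      rw [Ne, Subgroup.map_eq_bot_iff, QuotientGroup.ker_mk']; exact hN)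
  obtain ⟨u, hu, rfl⟩ := hvN
  refine ⟨u, hu, fun h => ?_, ?_, fun g => ?_⟩
  · rw [QuotientGroup.mk'_apply, (QuotientGroup.eq_one_iff u).2 h, orderOf_one] at hv
    exact (Fact.out : p.Prime).one_lt.ne hv
  · rw [← QuotientGroup.eq_one_iff, QuotientGroup.mk_pow, ← hv]
    exact pow_orderOf_eq_one _
  · rw [← QuotientGroup.eq_one_iff]
    have := Subgroup.mem_center_iff.1 hvc (QuotientGroup.mk' Z g)
    change ⁅QuotientGroup.mk' Z g, QuotientGroup.mk' Z u⁆ = 1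
    rwa [commutatorElement_eq_one_iff_mul_comm]

theorem isCyclic_of_ncard_pow_prime_eq_one_le {A : Type*} [CommGroup A] [Finite A] {p : ℕ}
    [hp : Fact p.Prime] (hA : IsPGroup p A) (h : {x : A | x ^ p = 1}.ncard ≤ p) : IsCyclic A := by
  classical
  have := Fintype.ofFinite A
  have hcard : ∀ k, (Finset.univ.filter fun x : A => x ^ p ^ k = 1).card ≤ p ^ k := by
    intro k
    induction k with
    | zero => simp [Finset.card_le_one]
    | succ k ih =>
      refine (Finset.card_le_mul_card_image_of_maps_to (f := fun x : A => x ^ p)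
        (t := Finset.univ.filter fun x : A => x ^ p ^ k = 1) ?_ p ?_).trans ?_
      · intro x hx
        simpa [← pow_mul, ← pow_succ'] using hx
      · intro b _
        rcases Finset.eq_empty_or_nonempty
          {x ∈ Finset.univ.filter fun x : A => x ^ p ^ (k + 1) = 1 | x ^ p = b} with h0 | ⟨c, hc⟩
        · simp [h0]
        · simp only [Finset.mem_filter, Finset.mem_univ, true_and] at hc
          refine le_trans ?_ h
          rw [Set.ncard_eq_toFinset_card']
          refine Finset.card_le_card_of_injOn (fun x => x * c⁻¹) ?_
            (mul_left_injective _).injOn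
          intro x hx
          simp only [Finset.coe_filter, Finset.mem_filter, Finset.mem_univ, true_and,
            Set.mem_ofPred_eq] at hx
          simp [mul_pow, hx.2, hc.2]
      · rw [pow_succ']
        exact Nat.mul_le_mul_left p ih
  refine isCyclic_of_card_pow_eq_one_le fun n hn => ?_
  obtain ⟨k, m, hm, rfl⟩ := Nat.exists_eq_pow_mul_and_not_dvd hn.ne' p hp.out.ne_one
  refine le_trans (Finset.card_le_card fun x hx => ?_) ((hcard k).trans
    (Nat.le_of_dvd hn (Dvd.intro m rfl)))
  simp only [Finset.mem_filter, Finset.mem_univ, true_and] at hx ⊢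
  rw [pow_mul] at hx
  have h1 := hA.orderOf_coprime ((Nat.Prime.coprime_iff_not_dvd hp.out).2 hm) (x ^ p ^ k)
  exact orderOf_eq_one_iff.1 (Nat.eq_one_of_dvd_coprimes h1 dvd_rfl (orderOf_dvd_of_pow_eq_one hx))

/-- `E` is a normal elementary abelian subgroup of order `p ^ 2`, and `z ∈ E` is a central element
of order `p` such that `E` is central modulo `⟨z⟩`. -/
structure Subgroup.IsNormalElementarySq (p : ℕ) (E : Subgroup G) (z : G) : Prop where
  card : Nat.card E = p ^ 2
  pow_eq_one : ∀ e ∈ E, e ^ p = 1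
  mem : z ∈ E
  mem_center : z ∈ Subgroup.center G
  orderOf_eq : orderOf z = p
  commutator_mem : ∀ g : G, ∀ e ∈ E, ⁅g, e⁆ ∈ Subgroup.zpowers z

theorem Subgroup.exists_isNormalElementarySq_of_element {p : ℕ} [hp : Fact p.Prime] {z u : G}
    (hz : z ∈ Subgroup.center G) (hzp : orderOf z = p) (hu : u ∉ Subgroup.zpowers z)
    (hup : u ^ p = 1) (hc : ∀ g : G, ⁅g, u⁆ ∈ Subgroup.zpowers z) :
    ∃ E : Subgroup G, E.IsNormalElementarySq p z := by
  have hZ := Subgroup.normal_zpowers_of_mem_center hz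
  set Z := Subgroup.zpowers z with hZdef
  set π := QuotientGroup.mk' Z with hπ
  have hsurj : Function.Surjective π := QuotientGroup.mk'_surjective Z
  have hmem : ∀ x, π x = 1 ↔ x ∈ Z := fun x => QuotientGroup.eq_one_iff x
  have huo : orderOf (π u) = p := orderOf_eq_prime (by rw [← map_pow, hup, map_one])
    (by rwa [Ne, hmem])
  have hcent : ∀ g, Commute (π g) (π u) := fun g => by
    have := (hmem _).2 (hc g)
    rwa [map_commutatorElement, commutatorElement_eq_one_iff_commute] at this
  refine ⟨(Subgroup.zpowers (π u)).comap π, ?_, ?_, ?_, hz, hzp, ?_⟩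
  · have h1 := ((Subgroup.zpowers (π u)).comap π).card_mul_index
    rw [Subgroup.index_comap_of_surjective _ hsurj] at h1
    have h2 := (Subgroup.zpowers (π u)).card_mul_index
    have h3 := Z.card_eq_card_quotient_mul_card_subgroup
    rw [← h2, Nat.card_zpowers, Nat.card_zpowers, huo, hzp, ← h1] at h3
    have h4 : 0 < (Subgroup.zpowers (π u)).index := Nat.pos_of_ne_zero
      Subgroup.index_ne_zero_of_finite
    nlinarith
  · intro e he
    obtain ⟨i, hi⟩ := Subgroup.mem_zpowers_iff.1 (Subgroup.mem_comap.1 he)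
    have : u ^ (-i) * e ∈ Z := by rw [← hmem]; simp [← hi]
    obtain ⟨j, hj⟩ := Subgroup.mem_zpowers_iff.1 this
    have he' : e = u ^ i * z ^ j := by rw [hj]; group
    have hcomm : Commute u z := Subgroup.mem_center_iff.1 hz u
    rw [he', (hcomm.zpow_zpow i j).mul_pow, ← zpow_natCast, ← zpow_natCast, zpow_comm,
      zpow_comm z, zpow_natCast, zpow_natCast, hup, ← hzp, pow_orderOf_eq_one]
    simp
  · rw [Subgroup.mem_comap, (hmem z).2 (Subgroup.mem_zpowers z)]
    exact one_mem _
  · intro g e he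
    obtain ⟨i, hi⟩ := Subgroup.mem_zpowers_iff.1 (Subgroup.mem_comap.1 he)
    rw [← hmem, map_commutatorElement, ← hi, commutatorElement_eq_one_iff_commute]
    exact (hcent g).zpow_right i

theorem IsPGroup.exists_isNormalElementarySq_of_normal {p : ℕ} [hp : Fact p.Prime]
    (hG : IsPGroup p G) (K : Subgroup G) [K.Normal] (hK : ∀ x ∈ K, x ^ p = 1)
    (hcard : p < Nat.card K) : ∃ (E : Subgroup G) (z : G), E.IsNormalElementarySq p z := by
  obtain ⟨z, hzK, hz, hzp⟩ := hG.exists_central_orderOf_eq_prime K (by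
    rintro rfl
    rw [Subgroup.card_bot] at hcard
    exact absurd hp.out.one_lt hcard.not_gt)
  have hZ := Subgroup.normal_zpowers_of_mem_center hz
  obtain ⟨u, huK, hu, -, hc⟩ := hG.exists_central_mod (Subgroup.zpowers z) K fun hle => by
    have := Subgroup.card_le_of_le hle
    rw [Nat.card_zpowers, hzp] at this
    omega
  obtain ⟨E, hE⟩ := Subgroup.exists_isNormalElementarySq_of_element hz hzp hu (hK u huK) hc
  exact ⟨E, z, hE⟩

theorem IsPGroup.exists_isNormalElementarySq_of_not_isCyclic {p : ℕ} [hp : Fact p.Prime]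
    (hG : IsPGroup p G) (N : Subgroup G) [N.Normal] (hcomm : ∀ x ∈ N, ∀ y ∈ N, x * y = y * x)
    (hN : ¬ IsCyclic N) : ∃ (E : Subgroup G) (z : G), E.IsNormalElementarySq p z := by
  let K : Subgroup G :=
    { carrier := {x | x ∈ N ∧ x ^ p = 1}
      one_mem' := ⟨one_mem _, one_pow _⟩
      mul_mem' := fun {x y} hx hy => ⟨mul_mem hx.1 hy.1, by
        rw [Commute.mul_pow (hcomm x hx.1 y hy.1), hx.2, hy.2, one_mul]⟩
      inv_mem' := fun {x} hx => ⟨inv_mem hx.1, by rw [inv_pow, hx.2, inv_one]⟩ }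
  have hKn : K.Normal := ⟨fun x hx g => ⟨Subgroup.Normal.conj_mem ‹_› x hx.1 g, by
    rw [conj_pow, hx.2, mul_one, mul_inv_cancel]⟩⟩
  refine hG.exists_isNormalElementarySq_of_normal K (fun x hx => hx.2) ?_
  by_contra! hle
  apply hN
  let _ : CommGroup N := { (inferInstance : Group N) with
    mul_comm := fun x y => Subtype.ext (hcomm x x.2 y y.2) }
  refine isCyclic_of_ncard_pow_prime_eq_one_le (hG.to_subgroup N) (le_trans ?_ hle)
  rw [← Nat.card_coe_set_eq]
  refine Nat.card_le_card_of_injective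
    (fun x => (⟨x.1.1, x.1.2, congrArg Subtype.val x.2⟩ : K)) fun x y hxy => ?_
  exact Subtype.ext (Subtype.ext (congrArg (fun k : K => k.1) hxy))

omit [Finite G] in
theorem Subgroup.IsNormalElementarySq.normal {p : ℕ} {E : Subgroup G} {z : G}
    (hE : E.IsNormalElementarySq p z) : E.Normal :=
  ⟨fun e he g => by
    have := mul_mem (Subgroup.zpowers_le.2 hE.mem (hE.commutator_mem g e he)) he
    rwa [commutatorElement_def, inv_mul_cancel_right] at this⟩

omit [Finite G] in
theorem Subgroup.IsNormalElementarySq.mul_comm {p : ℕ} [Fact p.Prime] {E : Subgroup G} {z : G}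
    (hE : E.IsNormalElementarySq p z) {x y : G} (hx : x ∈ E) (hy : y ∈ E) : x * y = y * x :=
  congrArg Subtype.val
    ((IsPGroup.isMulCommutative_of_card_eq_prime_sq hE.card).is_comm.comm ⟨x, hx⟩ ⟨y, hy⟩)

theorem IsPGroup.exists_isNormalElementarySq_of_ne_two {p : ℕ} [hp : Fact p.Prime] (hp2 : p ≠ 2)
    (hG : IsPGroup p G) (hnc : ¬ IsCyclic G) :
    ∃ (E : Subgroup G) (z : G), E.IsNormalElementarySq p z := by
  obtain ⟨n, hn⟩ : ∃ n, Nat.card G = n := ⟨_, rfl⟩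
  induction n using Nat.strong_induction_on generalizing G with
  | _ n ih =>
  have hnt : Nontrivial G := by
    by_contra h
    rw [not_nontrivial_iff_subsingleton] at h
    exact hnc inferInstance
  obtain ⟨z, -, hz, hzp⟩ := hG.exists_central_orderOf_eq_prime (⊤ : Subgroup G) top_ne_bot
  have hZ := Subgroup.normal_zpowers_of_mem_center hz
  set Z := Subgroup.zpowers z with hZdef
  have hZcard : Nat.card Z = p := by rw [Nat.card_zpowers, hzp]
  have hZpow : ∀ x ∈ Z, x ^ p = 1 := fun x hx => by
    rw [← hZcard]
    exact congrArg Subtype.val (pow_card_eq_one' (x := (⟨x, hx⟩ : Z)))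
  have hZcomm : ∀ x ∈ Z, ∀ y, Commute x y := fun x hx y =>
    (Subgroup.mem_center_iff.1 (Subgroup.zpowers_le.2 hz hx) y).symm
  by_cases hcyc : IsCyclic (G ⧸ Z)
  · have hcomm := (QuotientGroup.mk' Z).isMulCommutative_of_isCyclic_of_ker_le_center
      (by rw [QuotientGroup.ker_mk']; exact Subgroup.zpowers_le.2 hz)
    refine hG.exists_isNormalElementarySq_of_not_isCyclic ⊤
      (fun x _ y _ => hcomm.is_comm.comm x y) fun h => hnc ?_
    exact Subgroup.topEquiv.isCyclic.1 h
  have hcq := Z.card_eq_card_quotient_mul_card_subgroup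
  rw [hZcard] at hcq
  obtain ⟨E, e, hE⟩ := ih (Nat.card (G ⧸ Z)) (by
    rw [← hn, hcq]
    exact lt_mul_of_one_lt_right Nat.card_pos hp.out.one_lt) (hG.to_quotient Z) hcyc rfl
  set π := QuotientGroup.mk' Z with hπ
  have hsurj : Function.Surjective π := QuotientGroup.mk'_surjective Z
  have hmem : ∀ x, π x = 1 ↔ x ∈ Z := fun x => QuotientGroup.eq_one_iff x
  have hEn : E.Normal := hE.normal
  have hEcomm : ∀ x ∈ E, ∀ y ∈ E, x * y = y * x := fun x hx y hy =>
    hE.mul_comm hx hy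
  set F := E.comap π with hF
  have hFpow : ∀ x ∈ F, x ^ p ∈ Z := fun x hx => by
    rw [← hmem, map_pow, hE.pow_eq_one _ hx]
  have hmul : ∀ x ∈ F, ∀ y ∈ F, (x * y) ^ p = x ^ p * y ^ p := by
    intro x hx y hy
    have hc : (x * y)⁻¹ * (y * x) ∈ Z := by
      rw [← hmem, map_mul, map_inv, map_mul, map_mul, hEcomm _ hx _ hy, inv_mul_cancel]
    have := mul_pow_of_commutator_central (x := x) (y := y) (c := (x * y)⁻¹ * (y * x))
      (by group) (hZcomm _ hc _) (hZcomm _ hc _) p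
    obtain ⟨k, hk⟩ := hp.out.dvd_choose_self (k := 2) two_ne_zero
      (lt_of_le_of_ne hp.out.two_le hp2.symm)
    rw [this, hk, pow_mul, hZpow _ hc, one_pow, mul_one]
  let φ : F →* Z :=
    { toFun := fun x => ⟨x.1 ^ p, hFpow x x.2⟩
      map_one' := Subtype.ext (one_pow _)
      map_mul' := fun x y => Subtype.ext (hmul x x.2 y y.2) }
  have hφ : ∀ x : F, x ∈ φ.ker ↔ x.1 ^ p = 1 := fun x => by
    rw [MonoidHom.mem_ker, ← Subtype.val_inj]; rfl
  have hK : ∀ x ∈ φ.ker.map F.subtype, x ∈ F ∧ x ^ p = 1 := by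
    rintro _ ⟨x, hx, rfl⟩
    exact ⟨x.2, (hφ x).1 hx⟩
  have hFn : F.Normal := inferInstance
  have hKn : (φ.ker.map F.subtype).Normal := ⟨fun x hx g => by
    obtain ⟨h1, h2⟩ := hK x hx
    exact ⟨⟨g * x * g⁻¹, hFn.conj_mem x h1 g⟩, (hφ _).2
      (by rw [conj_pow, h2, mul_one, mul_inv_cancel]), rfl⟩⟩
  refine hG.exists_isNormalElementarySq_of_normal _ (fun x hx => (hK x hx).2) ?_
  rw [Subgroup.card_map_of_injective F.subtype_injective]
  have h1 := φ.ker.card_mul_index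
  have h2 : φ.ker.index ≤ p := by
    rw [Subgroup.index_ker, ← hZcard]
    exact Nat.card_le_card_of_injective _ φ.range.subtype_injective
  have h3 := F.card_mul_index
  have h4 := E.card_mul_index
  rw [Subgroup.index_comap_of_surjective _ hsurj] at h3
  rw [hE.card] at h4
  rw [← h4] at hcq
  have h5 : 0 < E.index := Nat.pos_of_ne_zero Subgroup.index_ne_zero_of_finite
  have h6 : Nat.card F = p ^ 3 := by
    apply Nat.eq_of_mul_eq_mul_right h5
    rw [h3, hcq]; ring
  have hpos := hp.out.one_lt
  by_contra! hle
  have : Nat.card F ≤ p * p := h1 ▸ Nat.mul_le_mul hle h2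
  rw [h6] at this
  nlinarith [Nat.mul_lt_mul_of_pos_right hpos (Nat.mul_pos hp.out.pos hp.out.pos)]

theorem Subgroup.IsNormalElementarySq.sq_dvd_ncard_of_ne_two {p : ℕ} [hp : Fact p.Prime]
    (hp2 : p ≠ 2) {E : Subgroup G} {z : G} (hE : E.IsNormalElementarySq p z) :
    p ^ 2 ∣ {x : G | x ^ p = 1}.ncard := by
  rw [← hE.card]
  refine E.card_dvd_ncard_of_mul_mem _ fun x hx e he => ?_
  rw [Set.mem_ofPred_eq] at hx ⊢
  have hc : (x * e)⁻¹ * (e * x) ∈ Subgroup.zpowers z := by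
    have h := hE.commutator_mem x⁻¹ e he
    have h2 := Subgroup.mem_center_iff.1 (Subgroup.zpowers_le.2 hE.mem_center h) e
    rwa [show (x * e)⁻¹ * (e * x) = e⁻¹ * (⁅x⁻¹, e⁆ * e) by rw [commutatorElement_def]; group,
      ← h2, inv_mul_cancel_left]
  obtain ⟨k, hk⟩ := hp.out.dvd_choose_self (k := 2) two_ne_zero
    (lt_of_le_of_ne hp.out.two_le hp2.symm)
  have hcc : ∀ y, Commute ((x * e)⁻¹ * (e * x)) y := fun y =>
    (Subgroup.mem_center_iff.1 (Subgroup.zpowers_le.2 hE.mem_center hc) y).symm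
  rw [mul_pow_of_commutator_central (c := (x * e)⁻¹ * (e * x)) (by group) (hcc _) (hcc _), hx,
    hE.pow_eq_one e he, hk, pow_mul,
    hE.pow_eq_one _ (Subgroup.zpowers_le.2 hE.mem hc), one_pow, mul_one, mul_one]

theorem IsPGroup.nilpotencyClass_le {p : ℕ} [hp : Fact p.Prime] {n : ℕ} [Group.IsNilpotent G]
    (hn : Nat.card G = p ^ n) (hn2 : 2 ≤ n) : Group.nilpotencyClass G ≤ n - 1 := by
  induction n using Nat.strong_induction_on generalizing G with
  | _ n ih =>
  have hG : IsPGroup p G := IsPGroup.of_card hn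
  have hnt : Nontrivial G := by
    rw [← Finite.one_lt_card_iff_nontrivial, hn]
    exact Nat.one_lt_pow (by omega) hp.out.one_lt
  rw [Group.nilpotencyClass_eq_quotient_center_plus_one]
  obtain ⟨m, hm⟩ := IsPGroup.iff_card.1 (hG.to_quotient (Subgroup.center G))
  obtain ⟨k, hk, hk'⟩ := IsPGroup.nontrivial_iff_card hG |>.1 hnt
  have hmn : m < n := by
    rw [← Nat.pow_lt_pow_iff_right hp.out.one_lt, ← hm, ← hn,
      (Subgroup.center G).card_eq_card_quotient_mul_card_subgroup]
    have := hG.center_nontrivial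
    exact lt_mul_of_one_lt_right Nat.card_pos (Finite.one_lt_card)
  rcases Nat.lt_or_ge 1 m with h | h
  · have := ih m hmn hm h
    omega
  · have hcyc : IsCyclic (G ⧸ Subgroup.center G) := by
      interval_cases m
      · have : Subsingleton (G ⧸ Subgroup.center G) :=
          (Nat.card_eq_one_iff_unique.1 (by simpa using hm)).1
        infer_instance
      · exact isCyclic_of_prime_card (by simpa using hm)
    have hcomm := (QuotientGroup.mk' (Subgroup.center G)).isMulCommutative_of_isCyclic_of_ker_le_center
      (by rw [QuotientGroup.ker_mk'])
    have h1 := Group.IsNilpotent.nilpotencyClass_le_one_iff.2 hcomm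
    rw [Group.nilpotencyClass_eq_quotient_center_plus_one] at h1
    omega

theorem IsPGroup.nilpotencyClass_eq_of_card_le {p : ℕ} [hp : Fact p.Prime] {n : ℕ}
    [Group.IsNilpotent G] (hn : Nat.card G = p ^ n) (hn3 : n ≤ 3) {a b : G} (hab : ¬ Commute a b) :
    Group.nilpotencyClass G = n - 1 := by
  have h1 : ¬ Group.nilpotencyClass G ≤ 1 := fun h =>
    hab ((Group.IsNilpotent.nilpotencyClass_le_one_iff.1 h).is_comm.comm a b)
  rcases Nat.lt_or_ge n 2 with h | h
  · have hcyc : IsCyclic G := by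
      interval_cases n
      · have : Subsingleton G := (Nat.card_eq_one_iff_unique.1 (by simpa using hn)).1
        infer_instance
      · exact isCyclic_of_prime_card (by simpa using hn)
    exact absurd (hcyc.isMulCommutative.is_comm.comm a b) hab
  · have := IsPGroup.nilpotencyClass_le hn h
    omega

theorem Subgroup.index_centralizer_singleton_le (Z : Subgroup G) {x : G}
    (h : ∀ g : G, ⁅g, x⁆ ∈ Z) : (Subgroup.centralizer {x}).index ≤ Nat.card Z := by
  refine Nat.card_le_card_of_injective
    (fun q : G ⧸ Subgroup.centralizer {x} => (⟨⁅q.out, x⁆, h _⟩ : Z)) fun q r hqr => ?_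
  have h1 : ⁅q.out, x⁆ = ⁅r.out, x⁆ := congrArg Subtype.val hqr
  rw [← q.out_eq, ← r.out_eq]
  refine QuotientGroup.eq.2 (Subgroup.mem_centralizer_singleton_iff.2 ?_)
  simp only [commutatorElement_def, mul_left_inj] at h1
  rw [mul_assoc, inv_mul_eq_iff_eq_mul]
  calc r.out * x = (r.out * x * r.out⁻¹) * r.out := by group
    _ = q.out * (x * (q.out⁻¹ * r.out)) := by rw [← h1]; group

omit [Finite G] in
theorem Subgroup.normal_centralizer_singleton {x : G}
    (h : ∀ g : G, ⁅g, x⁆ ∈ Subgroup.center G) : (Subgroup.centralizer {x}).Normal := by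
  refine ⟨fun y hy g => ?_⟩
  rw [Subgroup.mem_centralizer_singleton_iff] at hy ⊢
  have h1 : Commute y (⁅g⁻¹, x⁆ * x) :=
    Commute.mul_right (Subgroup.mem_center_iff.1 (h g⁻¹) y) hy
  rw [commutatorElement_def, inv_mul_cancel_right, inv_inv] at h1
  calc g * y * g⁻¹ * x = g * (y * (g⁻¹ * x * g)) * g⁻¹ := by group
    _ = x * (g * y * g⁻¹) := by rw [h1.eq]; group

omit [Finite G] in
theorem Subgroup.mem_zpowers_iff_of_orderOf_eq_two {z x : G} (hz : orderOf z = 2) :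
    x ∈ Subgroup.zpowers z ↔ x = 1 ∨ x = z := by
  constructor
  · rw [Subgroup.mem_zpowers_iff]
    rintro ⟨k, rfl⟩
    rcases Int.emod_two_eq_zero_or_one k with h | h
    · left; rw [← zpow_mod_orderOf, hz]; simp [h]
    · right; rw [← zpow_mod_orderOf, hz]; simp [h]
  · rintro (rfl | rfl)
    · exact one_mem _
    · exact Subgroup.mem_zpowers _

theorem Subgroup.IsNormalElementarySq.exists_generator {E : Subgroup G} {z : G}
    (hE : E.IsNormalElementarySq 2 z) :
    ∃ w ∈ E, w ∉ Subgroup.zpowers z ∧ ∀ e ∈ E, e = 1 ∨ e = z ∨ e = w ∨ e = w * z := by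
  obtain ⟨w, hw, hwz⟩ : ∃ w ∈ E, w ∉ Subgroup.zpowers z := by
    by_contra! h
    have := Subgroup.card_le_of_le (show E ≤ Subgroup.zpowers z from h)
    rw [hE.card, Nat.card_zpowers, hE.orderOf_eq] at this
    omega
  refine ⟨w, hw, hwz, ?_⟩
  rw [Subgroup.mem_zpowers_iff_of_orderOf_eq_two hE.orderOf_eq, not_or] at hwz
  have hz1 : z ≠ 1 := by
    rintro rfl
    simpa using hE.orderOf_eq
  have hsub : ({1, z, w, w * z} : Set G) ⊆ E := by
    rintro x (rfl | rfl | rfl | rfl)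
    exacts [one_mem _, hE.mem, hw, mul_mem hw hE.mem]
  have hwz1 : w * z ≠ 1 := fun h => hwz.2 (by
    have hz2 := hE.pow_eq_one z hE.mem
    rw [sq] at hz2
    exact mul_right_cancel (h.trans hz2.symm))
  have hcard : ({1, z, w, w * z} : Set G).ncard = 4 := by
    classical
    rw [Set.ncard_eq_toFinset_card']
    simp [hz1, hwz.1, Ne.symm hz1, Ne.symm hwz.1, Ne.symm hwz.2, Ne.symm hwz1]
  have heq := Set.eq_of_subset_of_ncard_le hsub (by
    rw [hcard, ← Nat.card_coe_set_eq]
    exact hE.card.le)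
  intro e he
  have : e ∈ ({1, z, w, w * z} : Set G) := heq ▸ he
  simpa using this

/-- The elements of the subgroup `C` which have square in `Z` and are central modulo `Z`. -/
def Subgroup.sqMemCentralMod (Z C : Subgroup G) [Z.Normal] : Subgroup G where
  carrier := {v | v ∈ C ∧ v ^ 2 ∈ Z ∧ ∀ g : G, ⁅g, v⁆ ∈ Z}
  one_mem' := ⟨one_mem _, by simp, fun g => by simp⟩
  mul_mem' {a b} ha hb := by
    simp only [← QuotientGroup.eq_one_iff, ← QuotientGroup.mk'_apply,
      map_commutatorElement, commutatorElement_eq_one_iff_commute, map_mul,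
      Set.mem_ofPred_eq, map_pow] at ha hb ⊢
    refine ⟨mul_mem ha.1 hb.1, ?_, fun g => (ha.2.2 g).mul_right (hb.2.2 g)⟩
    rw [(hb.2.2 a).mul_pow, ha.2.1, hb.2.1, one_mul]
  inv_mem' {a} ha := by
    simp only [← QuotientGroup.eq_one_iff, ← QuotientGroup.mk'_apply,
      map_commutatorElement, commutatorElement_eq_one_iff_commute, map_inv,
      Set.mem_ofPred_eq, map_pow] at ha ⊢
    exact ⟨inv_mem ha.1, by rw [inv_pow, ha.2.1, inv_one], fun g => (ha.2.2 g).inv_right⟩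

theorem Subgroup.card_sqMemCentralMod_dvd (Z C : Subgroup G) [Z.Normal] :
    Nat.card (Subgroup.sqMemCentralMod Z C) ∣ {y : G | y ∉ C ∧ y ^ 2 ∈ Z}.ncard := by
  refine Subgroup.card_dvd_ncard_of_mul_mem _ _ fun y hy v hv => ?_
  refine ⟨fun h => hy.1 ((Subgroup.mul_mem_cancel_right C hv.1).1 h), ?_⟩
  obtain ⟨-, hv2, hvc⟩ := hv
  have hy2 := hy.2
  have := hvc y
  rw [← QuotientGroup.eq_one_iff, ← QuotientGroup.mk'_apply] at this hv2 hy2 ⊢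
  rw [map_commutatorElement, commutatorElement_eq_one_iff_commute] at this
  rw [map_pow] at hv2 hy2 ⊢
  rw [map_mul, this.mul_pow, hv2, hy2, one_mul]

theorem Subgroup.IsNormalElementarySq.four_dvd_ncard [Group.IsNilpotent G] (hG : IsPGroup 2 G)
    (hmc : ∀ n : ℕ, Nat.card G = 2 ^ n → Group.nilpotencyClass G ≠ n - 1)
    {E : Subgroup G} {z : G} (hE : E.IsNormalElementarySq 2 z) :
    4 ∣ {x : G | x ^ 2 = 1}.ncard := by
  obtain ⟨w, hwE, hwZ, hEw⟩ := hE.exists_generator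
  have hZn := Subgroup.normal_zpowers_of_mem_center hE.mem_center
  have hZ : ∀ x, x ∈ Subgroup.zpowers z ↔ x = 1 ∨ x = z := fun x =>
    Subgroup.mem_zpowers_iff_of_orderOf_eq_two hE.orderOf_eq
  have hzc : ∀ g, Commute g z := Subgroup.mem_center_iff.1 hE.mem_center
  have hz1 : z ≠ 1 := by
    intro h
    have := hE.orderOf_eq
    rw [h, orderOf_one] at this
    omega
  have hz2 : z * z = 1 := by rw [← sq]; exact hE.pow_eq_one z hE.mem
  have hw2 : w * w = 1 := by rw [← sq]; exact hE.pow_eq_one w hwE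
  have hcw := fun g => hE.commutator_mem g w hwE
  have hCn := Subgroup.normal_centralizer_singleton
    fun g => Subgroup.zpowers_le.2 hE.mem_center (hcw g)
  set Z := Subgroup.zpowers z with hZdef
  set C := Subgroup.centralizer {w} with hCdef
  have hC : ∀ y, y ∈ C ↔ Commute y w := fun y => Subgroup.mem_centralizer_singleton_iff
  have hnC : ∀ y, y ∉ C → y * w = z * (w * y) := fun y hy => by
    rcases (hZ _).1 (hcw y) with h | h
    · exact absurd ((hC y).2 (commutatorElement_eq_one_iff_commute.1 h)) hy
    · rw [← h, commutatorElement_def]; group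
  have hT : {x : G | x ^ 2 = 1} = {x | x ∈ C ∧ x ^ 2 = 1} ∪ {x | x ∉ C ∧ x ^ 2 = 1} := by
    ext x
    simp only [Set.mem_ofPred_eq, Set.mem_union]
    tauto
  rw [hT, Set.ncard_union_eq (Set.disjoint_left.2 fun x h1 h2 => h2.1 h1.1)]
  refine dvd_add ?_ ?_
  · rw [show 4 = Nat.card E from hE.card.symm]
    refine E.card_dvd_ncard_of_mul_mem _ fun x hx e he => ?_
    have hxe : Commute x e := by
      have := (hC x).1 hx.1
      rcases hEw e he with rfl | rfl | rfl | rfl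
      exacts [Commute.one_right x, hzc x, this, this.mul_right (hzc x)]
    refine ⟨mul_mem hx.1 ((hC e).2 (hE.mul_comm he hwE)), ?_⟩
    rw [hxe.mul_pow, hx.2, hE.pow_eq_one e he, one_mul]
  have hsq : ∀ y, y ∉ C → (y * w) ^ 2 = z * y ^ 2 := fun y hy => by
    calc (y * w) ^ 2 = y * w * (y * w) := sq _
      _ = y * w * z * (w * y) := by rw [hnC y hy]; simp only [mul_assoc]
      _ = y * (z * (w * w)) * y := by rw [mul_assoc y, (hzc w).eq]; simp only [mul_assoc]
      _ = z * y ^ 2 := by rw [hw2, mul_one, (hzc y).eq, sq, mul_assoc]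
  have hmulw : ∀ y, y ∉ C → y * w ∉ C := fun y hy h =>
    hy ((Subgroup.mul_mem_cancel_right C ((hC w).2 (Commute.refl w))).1 h)
  set V := Subgroup.sqMemCentralMod Z C with hV
  have hEV : E ≤ V := fun e he => ⟨(hC e).2 (hE.mul_comm he hwE), by
    rw [hE.pow_eq_one e he]; exact one_mem _, fun g => hE.commutator_mem g e he⟩
  have hVY := Subgroup.card_sqMemCentralMod_dvd Z C
  rw [← hV] at hVY
  by_cases hVE : V ≤ E
  · refine Set.dvd_ncard_of_dvd_ncard_fiber _ ConjClasses.mk fun x hx => ?_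
    have hset : {x | x ∉ C ∧ x ^ 2 = 1} ∩ {y | ConjClasses.mk y = ConjClasses.mk x} =
        {y | IsConj x y} := by
      ext y
      simp only [Set.mem_inter_iff, Set.mem_ofPred_eq, ConjClasses.mk_eq_mk_iff_isConj]
      refine ⟨fun h => h.2.symm, fun h => ⟨?_, h.symm⟩⟩
      obtain ⟨g, rfl⟩ := isConj_iff.1 h
      refine ⟨fun h => hx.1 ?_, ?_⟩
      · simpa [mul_assoc] using hCn.conj_mem _ h g⁻¹
      · rw [conj_pow, hx.2, mul_one, mul_inv_cancel]
    rw [hset]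
    obtain ⟨n, hn⟩ := hG.ncard_conjClass x
    rw [hn]
    rcases Nat.lt_or_ge n 2 with hn2 | hn2
    swap
    · exact pow_dvd_pow 2 hn2
    exfalso
    have hxz : x * z ≠ x := by simpa using hz1
    have hcl : ({x, x * z} : Set G) = {y | IsConj x y} := by
      refine Set.eq_of_subset_of_ncard_le ?_ ?_
      · rintro y (rfl | rfl)
        · exact IsConj.refl _
        · refine isConj_iff.2 ⟨w, ?_⟩
          rw [mul_inv_eq_iff_eq_mul, mul_assoc, (hzc w).symm.eq, ← mul_assoc, hnC x hx.1,
            (hzc _).symm.eq, mul_assoc, hz2, mul_one]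
      · rw [hn, Set.ncard_pair hxz.symm]
        interval_cases n <;> simp
    have hcx : ∀ g : G, ⁅g, x⁆ ∈ Z := fun g => by
      have : g * x * g⁻¹ ∈ ({x, x * z} : Set G) := hcl ▸ isConj_iff.2 ⟨g, rfl⟩
      rw [commutatorElement_def]
      rcases this with h | h
      · rw [h, mul_inv_cancel]; exact one_mem _
      · rw [h, (hzc x).eq, mul_inv_cancel_right]; exact Subgroup.mem_zpowers z
    have hDn := Subgroup.normal_centralizer_singleton
      fun g => Subgroup.zpowers_le.2 hE.mem_center (hcx g)
    set D := Subgroup.centralizer {x} with hD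
    have hle : D ⊓ C ≤ Z := by
      by_contra hnle
      obtain ⟨u, hu, huZ, hu2, huc⟩ := hG.exists_central_mod Z (D ⊓ C) hnle
      have hux : Commute u x := Subgroup.mem_centralizer_singleton_iff.1 hu.1
      have huE : u ∈ E := hVE ⟨hu.2, hu2, huc⟩
      have hxw : ¬ Commute w x := fun h => hx.1 ((hC x).2 h.symm)
      rcases hEw u huE with rfl | rfl | rfl | rfl
      · exact huZ (one_mem _)
      · exact huZ (Subgroup.mem_zpowers _)
      · exact hxw hux
      · refine hxw ?_
        have := hux.mul_left (hzc x).symm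
        rwa [mul_assoc, hz2, mul_one] at this
    have hZcard : Nat.card Z = 2 := by rw [Nat.card_zpowers, hE.orderOf_eq]
    have hiD : D.index ≤ 2 := hZcard ▸ Z.index_centralizer_singleton_le hcx
    have hiC : C.index ≤ 2 := hZcard ▸ Z.index_centralizer_singleton_le hcw
    have hi : (D ⊓ C).index ≤ 4 := Subgroup.index_inf_le.trans (Nat.mul_le_mul hiD hiC)
    have hcard : Nat.card G ≤ 2 ^ 3 := by
      rw [← (D ⊓ C).card_mul_index]
      calc _ ≤ 2 * 4 := Nat.mul_le_mul ((Subgroup.card_le_of_le hle).trans hZcard.le) hi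
        _ = 2 ^ 3 := by norm_num
    obtain ⟨m, hm⟩ := IsPGroup.iff_card.1 hG
    rw [hm] at hcard
    exact hmc m hm (IsPGroup.nilpotencyClass_eq_of_card_le hm
      ((Nat.pow_le_pow_iff_right (by norm_num)).1 hcard) fun h => hx.1 ((hC x).2 h))
  · have h8 : 8 ∣ Nat.card V := by
      obtain ⟨m, hm⟩ := IsPGroup.iff_card.1 (hG.to_subgroup V)
      have hlt : Nat.card E < Nat.card V := by
        refine lt_of_le_of_ne (Subgroup.card_le_of_le hEV) fun h => hVE ?_
        exact (Subgroup.eq_of_le_of_card_ge hEV h.ge).ge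
      rw [hm, hE.card, Nat.pow_lt_pow_iff_right (by norm_num)] at hlt
      rw [hm]
      exact pow_dvd_pow 2 hlt
    have hY : {y : G | y ∉ C ∧ y ^ 2 ∈ Z} =
        {y | y ∉ C ∧ y ^ 2 = 1} ∪ {y | y ∉ C ∧ y ^ 2 = z} := by
      ext y
      simp only [Set.mem_ofPred_eq, Set.mem_union, hZ]
      tauto
    have hAB : {y : G | y ∉ C ∧ y ^ 2 = z} = (fun y => y * w) '' {y | y ∉ C ∧ y ^ 2 = 1} := by
      ext y
      constructor
      · intro hy
        exact ⟨y * w, ⟨hmulw y hy.1, by rw [hsq y hy.1, hy.2, hz2]⟩, by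
          simp only [mul_assoc, hw2, mul_one]⟩
      · rintro ⟨y, hy, rfl⟩
        exact ⟨hmulw y hy.1, by rw [hsq y hy.1, hy.2, mul_one]⟩
    have h := h8.trans hVY
    rw [hY, Set.ncard_union_eq (Set.disjoint_left.2 fun x h1 h2 => hz1 (h2.2.symm.trans h1.2)),
      hAB, Set.ncard_image_of_injective _ (mul_left_injective w)] at h
    omega

theorem IsPGroup.exists_normal_comm_self_centralizing {p : ℕ} [hp : Fact p.Prime]
    (hG : IsPGroup p G) : ∃ A : Subgroup G, A.Normal ∧ (∀ x ∈ A, ∀ y ∈ A, x * y = y * x) ∧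
      ∀ g, (∀ x ∈ A, Commute g x) → g ∈ A := by
  obtain ⟨A, ⟨hAn, hA⟩, hmax⟩ := Set.exists_max_image
    {A : Subgroup G | A.Normal ∧ ∀ x ∈ A, ∀ y ∈ A, x * y = y * x} (fun A => Nat.card A)
    (Set.toFinite _) ⟨⊥, inferInstance, by simp⟩
  refine ⟨A, hAn, hA, fun g hg => ?_⟩
  by_contra hgA
  have hgc : g ∈ Subgroup.centralizer (A : Set G) :=
    Subgroup.mem_centralizer_iff.2 fun x hx => (hg x hx).eq.symm
  obtain ⟨u, huC, huA, -, hc⟩ := hG.exists_central_mod A (Subgroup.centralizer (A : Set G))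
    fun h => hgA (h hgc)
  have huC' : ∀ x ∈ A, Commute u x := fun x hx => (Subgroup.mem_centralizer_iff.1 huC x hx).symm
  set π := QuotientGroup.mk' A with hπ
  have hmem : ∀ x, π x = 1 ↔ x ∈ A := fun x => QuotientGroup.eq_one_iff x
  have hB : ∀ x ∈ (Subgroup.zpowers (π u)).comap π, ∃ i : ℤ, ∃ y ∈ A, x = u ^ i * y := by
    intro x hx
    obtain ⟨i, hi⟩ := Subgroup.mem_zpowers_iff.1 (Subgroup.mem_comap.1 hx)
    exact ⟨i, u ^ (-i) * x, by rw [← hmem]; simp [← hi], by group⟩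
  have hcent : π u ∈ Subgroup.center (G ⧸ A) := Subgroup.mem_center_iff.2 fun q => by
    obtain ⟨g, rfl⟩ := QuotientGroup.mk'_surjective A q
    have := (hmem _).2 (hc g)
    rwa [map_commutatorElement, commutatorElement_eq_one_iff_mul_comm] at this
  have hn := Subgroup.normal_zpowers_of_mem_center hcent
  have hle : A ≤ (Subgroup.zpowers (π u)).comap π := fun x hx => by
    rw [Subgroup.mem_comap, (hmem x).2 hx]; exact one_mem _
  have := hmax ((Subgroup.zpowers (π u)).comap π) ⟨hn.comap π, fun x hx y hy => by
    obtain ⟨i, x', hx', rfl⟩ := hB x hx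
    obtain ⟨j, y', hy', rfl⟩ := hB y hy
    have h1 : Commute (u ^ i) (u ^ j * y') :=
      (Commute.zpow_zpow_self u i j).mul_right ((huC' y' hy').zpow_left i)
    have h2 : Commute x' (u ^ j * y') :=
      ((huC' x' hx').symm.zpow_right j).mul_right (hA x' hx' y' hy')
    exact h1.mul_left h2⟩
  have heq := Subgroup.eq_of_le_of_card_ge hle this
  exact huA (heq ▸ Subgroup.mem_zpowers (π u))

omit [Finite G] in
theorem conj_zpow_of_conj_eq {a g : G} {r : ℤ} (h : g * a * g⁻¹ = a ^ r) (j : ℤ) :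
    g * a ^ j * g⁻¹ = a ^ (r * j) := by
  rw [← conj_zpow, h, zpow_mul]

omit [Finite G] in
theorem mul_conj_of_conj_eq {a g h : G} {r s : ℤ} (hg : g * a * g⁻¹ = a ^ r)
    (hh : h * a * h⁻¹ = a ^ s) : (g * h) * a * (g * h)⁻¹ = a ^ (r * s) := by
  rw [← conj_zpow_of_conj_eq hg, ← hh]
  group

/-- An element inducing the automorphism `a ↦ a ^ (1 + 2 ^ (k - 1))` on a normal self-centralizing
subgroup `⟨a⟩` of order `2 ^ k = 8 q` produces a normal four-group. -/
theorem Subgroup.exists_isNormalElementarySq_of_conj_eq {a b : G} {q : ℕ}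
    (ha : orderOf a = 8 * q)
    (hodd : ∀ g : G, ∃ r : ℤ, Odd r ∧ g * a * g⁻¹ = a ^ r)
    (hself : ∀ g : G, Commute g a → ∃ i : ℤ, g = a ^ i) (hb : b * a * b⁻¹ = a ^ (1 + 4 * q : ℤ)) :
    ∃ (E : Subgroup G) (z : G), E.IsNormalElementarySq 2 z := by
  have hq : 0 < q := by
    have := orderOf_pos a
    omega
  have hq' : (q : ℤ) ≠ 0 := by exact_mod_cast hq.ne'
  have hone : ∀ x : ℤ, a ^ x = 1 ↔ (8 * q : ℤ) ∣ x := fun x => by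
    rw [← orderOf_dvd_iff_zpow_eq_one, ha]; push_cast; rfl
  have hcongr : ∀ x y : ℤ, (8 * q : ℤ) ∣ x - y → a ^ x = a ^ y := fun x y h => by
    rw [← mul_inv_eq_one, ← zpow_neg, ← zpow_add, hone]; exact h
  have hcomm : ∀ g : G, g * a * g⁻¹ = a → Commute g a := fun g h => by
    rwa [mul_inv_eq_iff_eq_mul] at h
  obtain ⟨t, ht2, hta⟩ : ∃ t : G, t * t = 1 ∧ t * a * t⁻¹ = a ^ (1 + 4 * q : ℤ) := by
    obtain ⟨i, hi⟩ := hself (b * b) (hcomm _ (by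
      rw [mul_conj_of_conj_eq hb hb]
      conv_rhs => rw [← zpow_one a]
      exact hcongr _ _ ⟨1 + 2 * q, by ring⟩))
    have h1 := conj_zpow_of_conj_eq hb i
    rw [← hi, show b * (b * b) * b⁻¹ = b * b by group, hi] at h1
    obtain ⟨s, rfl⟩ : ∃ s, i = 2 * s := by
      have h2 : a ^ ((1 + 4 * q) * i - i : ℤ) = 1 := by
        rw [zpow_sub, ← h1, mul_inv_cancel]
      obtain ⟨c, hc⟩ := (hone _).1 h2
      refine ⟨c, mul_left_cancel₀ (mul_ne_zero four_ne_zero hq') ?_⟩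
      linear_combination hc
    have hsq : ∀ m : ℤ, (b * a ^ m) * (b * a ^ m) = a ^ ((1 + 4 * q) * m + 2 * s + m : ℤ) :=
      fun m => by
        rw [zpow_add, zpow_add, ← hi, ← conj_zpow_of_conj_eq hb]; group
    have hact : ∀ m : ℤ, (b * a ^ m) * a * (b * a ^ m)⁻¹ = a ^ (1 + 4 * q : ℤ) := fun m => by
      rw [← hb]; group
    rcases Int.even_or_odd' s with ⟨c, rfl | rfl⟩
    · refine ⟨b * a ^ (-(2 * c)), ?_, hact _⟩
      rw [hsq, hone]
      exact ⟨-c, by ring⟩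
    · refine ⟨b * a ^ (-(2 * c + 1) + 2 * q : ℤ), ?_, hact _⟩
      rw [hsq, hone]
      exact ⟨q - c, by ring⟩
  have hz : a ^ (4 * q) ∈ Subgroup.center G := Subgroup.mem_center_iff.2 fun g => by
    obtain ⟨r, ⟨c, rfl⟩, hr⟩ := hodd g
    rw [← mul_inv_eq_iff_eq_mul, ← zpow_natCast, conj_zpow_of_conj_eq hr]
    refine hcongr _ _ ⟨c, ?_⟩
    push_cast; ring
  have hzp : orderOf (a ^ (4 * q)) = 2 := by
    refine orderOf_eq_prime ?_ fun h => ?_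
    · rw [← pow_mul, show 4 * q * 2 = 8 * q by ring, ← ha, pow_orderOf_eq_one]
    · have := Nat.le_of_dvd (by omega) (ha ▸ orderOf_dvd_of_pow_eq_one h)
      omega
  suffices h : t ∉ Subgroup.zpowers (a ^ (4 * q)) ∧ ∀ g : G, ⁅g, t⁆ ∈ Subgroup.zpowers (a ^ (4 * q)) by
    obtain ⟨E, hE⟩ := Subgroup.exists_isNormalElementarySq_of_element (p := 2) hz hzp h.1
      (by rw [sq, ht2]) h.2
    exact ⟨E, _, hE⟩
  refine ⟨fun h => ?_, fun g => ?_⟩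
  · have hc : Commute t a := (Subgroup.mem_center_iff.1 (Subgroup.zpowers_le.2 hz h) a).symm
    rw [hc.eq, mul_inv_cancel_right, zpow_add, zpow_one, eq_comm, mul_eq_left, hone] at hta
    have := Int.le_of_dvd (by omega) hta
    omega
  · obtain ⟨r, -, hr⟩ := hodd g
    obtain ⟨r', -, hr'⟩ := hodd g⁻¹
    have hrr : a ^ (r * r') = a := by
      rw [← mul_conj_of_conj_eq hr hr']; group
    have hact : (⁅g, t⁆) * a * (⁅g, t⁆)⁻¹ = a := by
      have htinv : t⁻¹ = t := inv_eq_of_mul_eq_one_left ht2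
      rw [commutatorElement_def, htinv,
        mul_conj_of_conj_eq (mul_conj_of_conj_eq (mul_conj_of_conj_eq hr hta) hr') hta,
        show r * (1 + 4 * q) * r' * (1 + 4 * q) = r * r' * ((1 + 4 * q) * (1 + 4 * q) : ℤ) by ring,
        zpow_mul, hrr]
      conv_rhs => rw [← zpow_one a]
      exact hcongr _ _ ⟨1 + 2 * q, by ring⟩
    obtain ⟨j, hj⟩ := hself _ (hcomm _ hact)
    have h1 : a ^ (j + (1 + 4 * q) * j : ℤ) = 1 := by
      rw [zpow_add, ← conj_zpow_of_conj_eq hta, ← hj, commutatorElement_def]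
      have htinv : t⁻¹ = t := inv_eq_of_mul_eq_one_left ht2
      calc g * t * g⁻¹ * t⁻¹ * (t * (g * t * g⁻¹ * t⁻¹) * t⁻¹)
          = g * (t * t) * g⁻¹ * (t * t)⁻¹ := by group
        _ = 1 := by rw [ht2]; group
    obtain ⟨c, hc⟩ := (hone _).1 h1
    rw [hj, Subgroup.mem_zpowers_iff]
    refine ⟨c * (1 - 2 * q) + q * j, ?_⟩
    rw [← zpow_natCast, ← zpow_mul]
    refine congrArg _ (mul_left_cancel₀ (two_ne_zero (α := ℤ)) ?_)
    push_cast
    linear_combination (2 * q - 1 : ℤ) * hc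

omit [Finite G] in
theorem Subgroup.zpow_mem_lowerCentralSeries_of_conj_eq {a b : G} {r : ℤ}
    (hb : b * a * b⁻¹ = a ^ r) (j : ℕ) :
    a ^ ((1 - r) ^ j) ∈ (⊤ : Subgroup G).lowerCentralSeries j := by
  induction j with
  | zero => simp
  | succ j ih =>
    have h := Subgroup.commutator_mem_commutator ih (Subgroup.mem_top b)
    have h1 : ⁅a ^ ((1 - r) ^ j), b⁆ = a ^ ((1 - r) ^ (j + 1)) := by
      rw [commutatorElement_def,
        show a ^ ((1 - r) ^ j) * b * (a ^ ((1 - r) ^ j))⁻¹ * b⁻¹ =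
          a ^ ((1 - r) ^ j) * (b * a ^ ((1 - r) ^ j) * b⁻¹)⁻¹ by group,
        conj_zpow_of_conj_eq hb, ← zpow_neg, ← zpow_add]
      congr 1
      ring
    rwa [h1] at h

omit [Finite G] in
theorem le_nilpotencyClass_of_conj_eq [Group.IsNilpotent G] {a b : G} {r : ℤ} {k : ℕ}
    (ha : orderOf a = 2 ^ k) (hb : b * a * b⁻¹ = a ^ r) (hr : 4 ∣ r + 1) :
    k ≤ Group.nilpotencyClass G := by
  by_contra! h
  obtain ⟨k, rfl⟩ : ∃ l, k = l + 1 := ⟨k - 1, by omega⟩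
  have h1 := Subgroup.zpow_mem_lowerCentralSeries_of_conj_eq hb k
  rw [Subgroup.lowerCentralSeries_eq_bot_iff_nilpotencyClass_le.2 (Nat.lt_succ_iff.1 h),
    Subgroup.mem_bot, ← orderOf_dvd_iff_zpow_eq_one, ha] at h1
  obtain ⟨s, hs⟩ := hr
  rw [show 1 - r = 2 * (1 - 2 * s) by linear_combination -hs, mul_pow, pow_succ] at h1
  push_cast at h1
  have h2 := Int.dvd_of_mul_dvd_mul_left (by positivity) h1
  have h3 : Odd ((1 - 2 * s) ^ k) := Odd.pow ⟨-s, by ring⟩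
  exact Int.not_even_iff_odd.2 h3 (even_iff_two_dvd.2 h2)

omit [Finite G] in
/-- If no element induces `a ↦ a ^ (1 + 2 ^ (k - 1))` on a normal self-centralizing subgroup `⟨a⟩`
of order `2 ^ k`, then involutions of `G / ⟨a⟩` act on `⟨a⟩` as inversion modulo `2 ^ (k - 1)`. -/
theorem dvd_add_one_of_conj_eq {a h : G} {m : ℕ} {r : ℤ} (ha : orderOf a = 8 * 2 ^ m)
    (hself : ∀ g : G, Commute g a → ∃ i : ℤ, g = a ^ i)
    (hno : ∀ b : G, b * a * b⁻¹ ≠ a ^ (1 + 4 * (2 ^ m : ℕ) : ℤ))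
    (hh : h ∉ Subgroup.zpowers a) (hhh : h * h ∈ Subgroup.zpowers a) (hodd : Odd r)
    (hr : h * a * h⁻¹ = a ^ r) : 4 * 2 ^ m ∣ r + 1 := by
  have hone : ∀ x : ℤ, a ^ x = 1 ↔ (8 * 2 ^ m : ℤ) ∣ x := fun x => by
    rw [← orderOf_dvd_iff_zpow_eq_one, ha]; push_cast; rfl
  have hcongr : ∀ x y : ℤ, (8 * 2 ^ m : ℤ) ∣ x - y → a ^ x = a ^ y := fun x y h => by
    rw [← mul_inv_eq_one, ← zpow_neg, ← zpow_add, hone]; exact h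
  have hsq : (8 * 2 ^ m : ℤ) ∣ r * r - 1 := by
    obtain ⟨i, hi⟩ := Subgroup.mem_zpowers_iff.1 hhh
    rw [← hone, zpow_sub, ← mul_conj_of_conj_eq hr hr, ← hi]
    group
  have hcop : ∀ s t : ℤ, (2 ^ m : ℤ) ∣ s * (2 * t + 1) → (2 ^ m : ℤ) ∣ s := fun s t h =>
    IsCoprime.dvd_of_dvd_mul_right (IsCoprime.pow_left ⟨-t, 1, by ring⟩) h
  obtain ⟨u, rfl⟩ := hodd
  obtain ⟨s, rfl | rfl⟩ := Int.even_or_odd' u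
  · have h1 : (2 ^ m : ℤ) ∣ s := by
      refine hcop s s (Int.dvd_of_mul_dvd_mul_left (show (8 : ℤ) ≠ 0 by norm_num) ?_)
      convert hsq using 1
      ring
    obtain ⟨c, rfl⟩ := h1
    obtain ⟨d, rfl | rfl⟩ := Int.even_or_odd' c
    · rw [hcongr _ 1 ⟨d, by ring⟩, zpow_one, mul_inv_eq_iff_eq_mul] at hr
      obtain ⟨i, rfl⟩ := hself h hr
      exact absurd (Subgroup.mem_zpowers_iff.2 ⟨i, rfl⟩) hh
    · refine absurd (hr.trans (hcongr _ _ ⟨d, ?_⟩)) (hno h)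
      push_cast
      ring
  · have h1 : (2 ^ m : ℤ) ∣ s + 1 := by
      refine hcop (s + 1) s (Int.dvd_of_mul_dvd_mul_left (show (8 : ℤ) ≠ 0 by norm_num) ?_)
      convert hsq using 1
      ring
    obtain ⟨c, hc⟩ := h1
    exact ⟨c, by linear_combination 4 * hc⟩

omit [Finite G] in
theorem index_zpowers_eq_two_of_conj_ne (hG : IsPGroup 2 G) {a b : G} {m : ℕ}
    (ha : orderOf a = 8 * 2 ^ m)
    (hodd : ∀ g : G, ∃ r : ℤ, Odd r ∧ g * a * g⁻¹ = a ^ r)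
    (hself : ∀ g : G, Commute g a → ∃ i : ℤ, g = a ^ i)
    (hno : ∀ b : G, b * a * b⁻¹ ≠ a ^ (1 + 4 * (2 ^ m : ℕ) : ℤ))
    (hb : b ∉ Subgroup.zpowers a) :
    (Subgroup.zpowers a).index = 2 ∧ ∃ r : ℤ, 4 ∣ r + 1 ∧ b * a * b⁻¹ = a ^ r := by
  have key : ∀ (h : G) (r : ℤ), h ∉ Subgroup.zpowers a → h * h ∈ Subgroup.zpowers a → Odd r →
      h * a * h⁻¹ = a ^ r → 4 * 2 ^ m ∣ r + 1 := fun h r hh hhh hor hr =>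
    dvd_add_one_of_conj_eq ha hself hno hh hhh hor hr
  have hsq : ∀ h : G, h * h ∈ Subgroup.zpowers a := by
    have hpow : ∀ (n : ℕ) (h : G), h ^ 2 ^ n ∈ Subgroup.zpowers a → h * h ∈ Subgroup.zpowers a := by
      intro n
      induction n with
      | zero => intro h hh; rw [pow_zero, pow_one] at hh; exact mul_mem hh hh
      | succ n ih =>
        intro h hh
        rcases n with _ | n
        · rwa [zero_add, pow_one, sq] at hh
        refine ih h ?_
        by_contra hn
        obtain ⟨r, ⟨c, rfl⟩, hr⟩ := hodd (h ^ 2 ^ n)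
        have h2 : h ^ 2 ^ (n + 1) = h ^ 2 ^ n * h ^ 2 ^ n := by rw [← pow_add]; ring_nf
        have h1 := key (h ^ 2 ^ (n + 1)) ((2 * c + 1) * (2 * c + 1)) hn
          (by rwa [← pow_add, ← two_mul, ← pow_succ'])
          (Odd.mul ⟨c, rfl⟩ ⟨c, rfl⟩) (by rw [h2, mul_conj_of_conj_eq hr hr])
        have h4 : (4 : ℤ) ∣ (2 * c + 1) * (2 * c + 1) + 1 := (Dvd.intro _ rfl).trans h1
        have h5 : (4 : ℤ) ∣ 2 := by
          rw [show (2 : ℤ) = (2 * c + 1) * (2 * c + 1) + 1 - 4 * (c * c + c) by ring]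
          exact dvd_sub h4 (Dvd.intro _ rfl)
        norm_num at h5
    intro h
    obtain ⟨n, hn⟩ := hG h
    exact hpow n h (hn ▸ one_mem _)
  obtain ⟨r, hro, hr⟩ := hodd b
  have hr1 := key b r hb (hsq b) hro hr
  refine ⟨Subgroup.index_eq_two_iff.2 ⟨b, fun g => ?_⟩, r, (Dvd.intro _ rfl).trans hr1, hr⟩
  by_cases hg : g ∈ Subgroup.zpowers a
  · exact Or.inr ⟨hg, fun h => hb ((Subgroup.mul_mem_cancel_left _ hg).1 h)⟩
  refine Or.inl ⟨?_, hg⟩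
  by_contra hgb
  obtain ⟨s, hso, hs⟩ := hodd g
  have h1 := key g s hg (hsq g) hso hs
  have h2 := key (g * b) (s * r) hgb (hsq _) (hso.mul hro) (mul_conj_of_conj_eq hs hr)
  have h4 : (4 : ℤ) ∣ r + 1 := (Dvd.intro _ rfl).trans hr1
  have h5 : (4 : ℤ) ∣ s + 1 := (Dvd.intro _ rfl).trans h1
  have h6 : (4 : ℤ) ∣ s * r + 1 := (Dvd.intro _ rfl).trans h2
  have h7 : (4 : ℤ) ∣ 2 := by
    rw [show (2 : ℤ) = s * r + 1 - s * (r + 1) + (s + 1) by ring]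
    exact dvd_add (dvd_sub h6 (h4.mul_left s)) h5
  norm_num at h7

theorem IsPGroup.exists_isNormalElementarySq_of_two [Group.IsNilpotent G] (hG : IsPGroup 2 G)
    (hnc : ¬ IsCyclic G)
    (hmc : ∀ n : ℕ, Nat.card G = 2 ^ n → Group.nilpotencyClass G ≠ n - 1) :
    ∃ (E : Subgroup G) (z : G), E.IsNormalElementarySq 2 z := by
  by_contra hno
  have : Fact (Nat.Prime 2) := ⟨Nat.prime_two⟩
  obtain ⟨A, hAn, hA, hAself⟩ := hG.exists_normal_comm_self_centralizing
  have hAc : IsCyclic A := by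
    by_contra h
    exact hno (hG.exists_isNormalElementarySq_of_not_isCyclic A hA h)
  obtain ⟨a, rfl⟩ := A.isCyclic_iff_exists_zpowers_eq_top.1 hAc
  have hself' : ∀ g, Commute g a → g ∈ Subgroup.zpowers a := fun g hg => hAself g fun x hx => by
    obtain ⟨i, rfl⟩ := Subgroup.mem_zpowers_iff.1 hx
    exact hg.zpow_right i
  have hself : ∀ g : G, Commute g a → ∃ i : ℤ, g = a ^ i := fun g hg => by
    obtain ⟨i, hi⟩ := Subgroup.mem_zpowers_iff.1 (hself' g hg)
    exact ⟨i, hi.symm⟩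
  obtain ⟨b, hb⟩ : ∃ b, b ∉ Subgroup.zpowers a := by
    by_contra! h
    exact hnc ⟨a, h⟩
  have hba : ¬ Commute b a := fun h => hb (hself' b h)
  have hpow : ∀ g : G, ∃ r : ℤ, g * a * g⁻¹ = a ^ r := fun g => by
    obtain ⟨i, hi⟩ := Subgroup.mem_zpowers_iff.1 (hAn.conj_mem a (Subgroup.mem_zpowers a) g)
    exact ⟨i, hi.symm⟩
  obtain ⟨k, hk⟩ := IsPGroup.iff_orderOf.1 hG a
  have hk0 : k ≠ 0 := by
    rintro rfl
    rw [pow_zero, orderOf_eq_one_iff] at hk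
    exact hba (hk ▸ Commute.one_right b)
  obtain ⟨k, rfl⟩ := Nat.exists_eq_add_one_of_ne_zero hk0
  have hodd : ∀ g : G, ∃ r : ℤ, Odd r ∧ g * a * g⁻¹ = a ^ r := fun g => by
    obtain ⟨r, hr⟩ := hpow g
    refine ⟨r, ?_, hr⟩
    rw [← Int.not_even_iff_odd]
    rintro ⟨s, rfl⟩
    have h1 := conj_zpow_of_conj_eq hr (2 ^ k)
    have h2 : a ^ ((s + s) * 2 ^ k : ℤ) = 1 := by
      rw [← orderOf_dvd_iff_zpow_eq_one, hk]
      exact ⟨s, by push_cast; ring⟩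
    rw [h2, conj_eq_one_iff, ← orderOf_dvd_iff_zpow_eq_one, hk] at h1
    have h3 := Int.le_of_dvd (by positivity) h1
    push_cast at h3
    rw [pow_succ] at h3
    have : (0 : ℤ) < 2 ^ k := by positivity
    omega
  rcases Nat.lt_or_ge k 2 with hk2 | hk2
  · have hi : (Subgroup.centralizer {a}).index ≤ 2 := by
      refine (Subgroup.index_centralizer_singleton_le (Subgroup.zpowers (a ^ 2)) fun g => ?_).trans ?_
      · obtain ⟨r, ⟨s, rfl⟩, hr⟩ := hodd g
        refine Subgroup.mem_zpowers_iff.2 ⟨s, ?_⟩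
        rw [commutatorElement_def, hr, zpow_add, zpow_one, mul_inv_cancel_right, zpow_mul,
          zpow_ofNat]
      · rw [Nat.card_zpowers, orderOf_pow, hk]
        interval_cases k <;> norm_num
    have hle : Subgroup.centralizer {a} ≤ Subgroup.zpowers a := fun x hx =>
      hself' x (Subgroup.mem_centralizer_singleton_iff.1 hx)
    have hcard : Nat.card G ≤ 2 ^ 3 := by
      rw [← (Subgroup.centralizer {a}).card_mul_index]
      calc _ ≤ 2 ^ (k + 1) * 2 := Nat.mul_le_mul
            ((Subgroup.card_le_of_le hle).trans (by rw [Nat.card_zpowers, hk])) hi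
        _ = 2 ^ (k + 2) := by ring
        _ ≤ 2 ^ 3 := Nat.pow_le_pow_right (by norm_num) (by omega)
    obtain ⟨n, hn⟩ := IsPGroup.iff_card.1 hG
    rw [hn] at hcard
    exact hmc n hn (IsPGroup.nilpotencyClass_eq_of_card_le hn
      ((Nat.pow_le_pow_iff_right (by norm_num)).1 hcard) hba)
  · obtain ⟨m, rfl⟩ := Nat.exists_eq_add_of_le hk2
    have hk' : orderOf a = 8 * 2 ^ m := by rw [hk]; ring
    obtain ⟨hi, r, hr4, hr⟩ := index_zpowers_eq_two_of_conj_ne hG hk' hodd hself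
      (fun b hb => hno (Subgroup.exists_isNormalElementarySq_of_conj_eq hk' hodd hself hb)) hb
    have hn : Nat.card G = 2 ^ (2 + m + 1 + 1) := by
      rw [← (Subgroup.zpowers a).card_mul_index, hi, Nat.card_zpowers, hk, ← pow_succ]
    have h1 := le_nilpotencyClass_of_conj_eq hk hr hr4
    have h2 := IsPGroup.nilpotencyClass_le hn (by omega)
    exact hmc _ hn (by omega)

theorem ncard_pow_prime_eq_one {p : ℕ} (hp : p.Prime) :
    {x : G | x ^ p = 1}.ncard = 1 + Nat.card {H : Subgroup G // Nat.card H = p} * (p - 1) := by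
  have : Fact p.Prime := ⟨hp⟩
  let e : {x : G // x ^ p = 1 ∧ x ≠ 1} ≃
      Σ H : {H : Subgroup G // Nat.card H = p}, {x : H.1 // x ≠ 1} :=
    { toFun := fun x => ⟨⟨Subgroup.zpowers x.1, by
          rw [Nat.card_zpowers, orderOf_eq_prime x.2.1 x.2.2]⟩,
        ⟨⟨x.1, Subgroup.mem_zpowers _⟩, fun h => x.2.2 (congrArg Subtype.val h)⟩⟩
      invFun := fun y => ⟨y.2.1.1, by
        have := congrArg Subtype.val (pow_card_eq_one' (x := y.2.1))
        rwa [y.1.2] at this, fun h => y.2.2 (Subtype.ext h)⟩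
      left_inv := fun x => rfl
      right_inv := by
        rintro ⟨⟨H, hH⟩, ⟨⟨x, hx⟩, hx1⟩⟩
        have h1 : x ≠ 1 := fun h => hx1 (Subtype.ext h)
        have h2 : x ^ p = 1 := by
          have := congrArg Subtype.val (pow_card_eq_one' (x := (⟨x, hx⟩ : H)))
          rwa [hH] at this
        obtain rfl : Subgroup.zpowers x = H := Subgroup.eq_of_le_of_card_ge
          (Subgroup.zpowers_le.2 hx) (by rw [hH, Nat.card_zpowers, orderOf_eq_prime h2 h1])
        rfl }
  have h1 : Nat.card {x : G // x ^ p = 1 ∧ x ≠ 1} =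
      Nat.card {H : Subgroup G // Nat.card H = p} * (p - 1) := by
    have hfib (H : {H : Subgroup G // Nat.card H = p}) : Nat.card {x : H.1 // x ≠ 1} = p - 1 := by
      have h := Set.ncard_compl ({1} : Set H.1)
      rwa [Set.ncard_singleton, H.2] at h
    have := Fintype.ofFinite {H : Subgroup G // Nat.card H = p}
    rw [Nat.card_congr e, Nat.card_sigma]
    simp [hfib]
  have h2 : {x : G | x ^ p = 1} = insert 1 {x | x ^ p = 1 ∧ x ≠ 1} := by
    ext x
    by_cases h : x = 1 <;> simp [h]
  rw [h2, Set.ncard_insert_of_notMem (by simp), ← Nat.card_coe_set_eq, add_comm]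
  exact congrArg (1 + ·) h1

theorem IsPGroup.sq_dvd_ncard_pow_prime_eq_one [Group.IsNilpotent G] {p : ℕ} (hp : p.Prime)
    (hG : IsPGroup p G) (hnc : ¬ IsCyclic G)
    (hmc : p = 2 → ∀ n : ℕ, Nat.card G = 2 ^ n → Group.nilpotencyClass G ≠ n - 1) :
    p ^ 2 ∣ {x : G | x ^ p = 1}.ncard := by
  have : Fact p.Prime := ⟨hp⟩
  by_cases hp2 : p = 2
  · subst hp2
    obtain ⟨E, z, hE⟩ := hG.exists_isNormalElementarySq_of_two hnc (hmc rfl)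
    exact hE.four_dvd_ncard hG (hmc rfl)
  · obtain ⟨E, z, hE⟩ := IsPGroup.exists_isNormalElementarySq_of_ne_two hp2 hG hnc
    exact hE.sq_dvd_ncard_of_ne_two hp2

end

/-- Let p be a prime and let G be a finite non-cyclic p-group; if p = 2,
assume moreover that G is not of maximal class (i.e., if |G| = 2ⁿ then the nilpotency
class of G is not n − 1). Then the number of subgroups of G of order p is congruent
to 1 + p modulo p².  (Note: every finite p-group is nilpotent, so the instance
`Group.IsNilpotent G` is automatic and only used to speak of the nilpotency class.) -/
theorem num_subgroups_order_p_modeq (p : ℕ) (hp : p.Prime)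
    {G : Type*} [Group G] [Finite G] [Group.IsNilpotent G]
    (hG : IsPGroup p G) (hnc : ¬ IsCyclic G)
    (hmc : p = 2 → ∀ n : ℕ, Nat.card G = 2 ^ n → Group.nilpotencyClass G ≠ n - 1) :
    Nat.card {H : Subgroup G // Nat.card H = p} ≡ 1 + p [MOD p ^ 2] := by
  have h := hG.sq_dvd_ncard_pow_prime_eq_one hp hnc hmc
  rw [ncard_pow_prime_eq_one hp] at h
  obtain ⟨d, hd⟩ := h
  generalize Nat.card {H : Subgroup G // Nat.card H = p} = c at hd ⊢
  obtain ⟨l, rfl⟩ : ∃ l, p = l + 1 := ⟨p - 1, by have := hp.pos; omega⟩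
  rw [Nat.add_sub_cancel] at hd
  zify at hd
  refine (Int.natCast_modEq_iff.1 (Int.modEq_iff_dvd.2 ⟨(1 + (l + 1)) * d - c, ?_⟩))
  push_cast
  linear_combination (1 + (l + 1 : ℤ)) * hd
end

section
/- Let p be a prime and let G be a finite non-cyclic p-group of exponent p^k; if p = 2, assume moreover that G is not of maximal class (i.e., if |G| = 2ⁿ then the nilpotency class of G is not n − 1). Then for every i with 2 ≤ i ≤ k, p divides the number of cyclic subgroups of G of order p^i. -/
open Subgroup in
theorem ncard_zpowers_eq {G : Type*} [Group G] [Finite G] (x : G) :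
    {y : G | zpowers y = zpowers x}.ncard = (orderOf x).totient := by
  classical
  have := Fintype.ofFinite G
  have h := IsCyclic.card_orderOf_eq_totient (α := zpowers x) (d := orderOf x)
    (by rw [← Nat.card_eq_fintype_card, Nat.card_zpowers])
  rw [← h, ← Set.ncard_coe_finset, ← Set.ncard_image_of_injective _ Subtype.val_injective]
  congr 1
  ext y
  simp only [Set.mem_ofPred_eq, Finset.coe_filter, Finset.mem_univ, true_and, Set.mem_image,
    Subtype.exists, exists_and_right, exists_eq_right]
  constructor
  · intro hy
    have hyx : y ∈ zpowers x := hy ▸ mem_zpowers y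
    refine ⟨hyx, ?_⟩
    rw [orderOf_mk, ← Nat.card_zpowers, hy, Nat.card_zpowers]
  · rintro ⟨hyx, hy⟩
    rw [orderOf_mk] at hy
    refine eq_of_le_of_card_ge (zpowers_le.mpr hyx) ?_
    rw [Nat.card_zpowers, Nat.card_zpowers, hy]

theorem dvd_ncard_of_dvd_totient_orderOf {G : Type*} [Group G] [Finite G] {X : Set G} {d : ℕ}
    (hX : ∀ x ∈ X, ∀ y, Subgroup.zpowers y = Subgroup.zpowers x → y ∈ X)
    (hd : ∀ x ∈ X, d ∣ (orderOf x).totient) : d ∣ X.ncard := by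
  classical
  have := Fintype.ofFinite G
  have h := Finset.card_eq_sum_card_fiberwise (f := fun x : G ↦ Subgroup.zpowers x)
    (s := X.toFinset) (t := X.toFinset.image fun x : G ↦ Subgroup.zpowers x)
    (fun x hx ↦ by simpa using ⟨x, by simpa using hx, rfl⟩)
  rw [Set.ncard_eq_toFinset_card', h]
  refine Finset.dvd_sum fun H hH ↦ ?_
  obtain ⟨x, hx, rfl⟩ := Finset.mem_image.mp hH
  rw [Set.mem_toFinset] at hx
  convert! hd x hx using 1
  rw [← ncard_zpowers_eq, ← Set.ncard_coe_finset]
  congr 1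
  ext y
  simpa using fun hy ↦ hX x hx y hy

theorem ncard_orderOf_eq {G : Type*} [Group G] [Finite G] (n : ℕ) :
    {x : G | orderOf x = n}.ncard =
      n.totient * Nat.card {H : Subgroup G // IsCyclic H ∧ Nat.card H = n} := by
  classical
  have := Fintype.ofFinite G
  have h := Finset.card_eq_sum_card_fiberwise (f := fun x : G ↦ Subgroup.zpowers x)
    (s := {x : G | orderOf x = n}) (t := {H : Subgroup G | IsCyclic H ∧ Nat.card H = n})
    (fun x hx ↦ by
      simp only [Finset.coe_filter, Finset.mem_univ, true_and, Set.mem_ofPred_eq] at hx ⊢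
      exact ⟨inferInstance, by rw [Nat.card_zpowers, hx]⟩)
  rw [Set.ncard_eq_toFinset_card', Set.toFinset_ofPred, h, Nat.card_eq_fintype_card,
    Fintype.card_subtype, mul_comm, ← smul_eq_mul, ← Finset.sum_const]
  refine Finset.sum_congr rfl fun H hH ↦ ?_
  obtain ⟨hc, hn⟩ := (Finset.mem_filter.mp hH).2
  obtain ⟨x, rfl⟩ := (Subgroup.isCyclic_iff_exists_zpowers_eq_top H).mp hc
  rw [Nat.card_zpowers] at hn
  rw [← hn, ← ncard_zpowers_eq, ← Set.ncard_coe_finset]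
  congr 1
  ext y
  simp only [Finset.coe_filter, Finset.mem_univ, true_and, Finset.mem_filter, Set.mem_ofPred_eq,
    and_iff_right_iff_imp]
  intro hy
  rw [← Nat.card_zpowers, hy, Nat.card_zpowers]

theorem ncard_eq_card_mul_ncard_image_mk {G : Type*} [Group G] (K : Subgroup G) {X : Set G}
    (hX : ∀ x ∈ X, ∀ k ∈ K, x * k ∈ X) :
    X.ncard = Nat.card K * ((QuotientGroup.mk : G → G ⧸ K) '' X).ncard := by
  have h : (QuotientGroup.mk : G → G ⧸ K) ⁻¹' (QuotientGroup.mk '' X) = X := by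
    refine (Set.subset_preimage_image _ _).antisymm' ?_
    rintro y ⟨x, hx, hxy⟩
    simpa using hX x hx _ (QuotientGroup.eq.mp hxy)
  rw [← Nat.card_coe_set_eq, ← Nat.card_coe_set_eq, ← Nat.card_prod,
    ← Nat.card_congr (QuotientGroup.preimageMkEquivSubgroupProdSet K _), h]

theorem dvd_card_cyclic_of_pow_dvd_ncard {G : Type*} [Group G] [Finite G] {p i : ℕ}
    (hp : p.Prime) (hi : 0 < i) (h : p ^ i ∣ {x : G | orderOf x = p ^ i}.ncard) :
    p ∣ Nat.card {H : Subgroup G // IsCyclic H ∧ Nat.card H = p ^ i} := by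
  obtain ⟨j, rfl⟩ : ∃ j, i = j + 1 := ⟨i - 1, by omega⟩
  rw [ncard_orderOf_eq, Nat.totient_prime_pow_succ hp, pow_succ, mul_assoc] at h
  refine (Nat.Coprime.dvd_mul_left ?_).mp (Nat.dvd_of_mul_dvd_mul_left (pow_pos hp.pos j) h)
  exact (Nat.coprime_self_sub_right hp.one_le).mpr (Nat.coprime_one_right p)

theorem exists_mem_center_orderOf_eq {G : Type*} [Group G] [Finite G] {p : ℕ} [Fact p.Prime]
    (hG : IsPGroup p G) {S : Subgroup G} [S.Normal] (hS : S ≠ ⊥) :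
    ∃ s ∈ S, s ∈ Subgroup.center G ∧ orderOf s = p := by
  have hdvd : p ∣ Nat.card S := (hG.to_subgroup S).card_eq_or_dvd.resolve_left
    (fun h ↦ hS (Subgroup.card_eq_one.mp h))
  have hconj := hG.of_equiv ConjAct.toConjAct
  obtain ⟨b, hb, hb1⟩ := hconj.exists_fixed_point_of_prime_dvd_card_of_fixed_point S hdvd
    (a := 1) (fun g ↦ smul_one g)
  have hbc : (b : G) ∈ Subgroup.center G := by
    rw [Subgroup.mem_center_iff]
    intro g
    have := congrArg Subtype.val (hb (ConjAct.toConjAct g))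
    rw [ConjAct.Subgroup.val_conj_smul, ConjAct.toConjAct_smul] at this
    exact mul_inv_eq_iff_eq_mul.mp this
  have hb2 : (b : G) ≠ 1 := fun h ↦ hb1 (Subtype.ext h.symm)
  have hd := hG.dvd_orderOf hb2
  refine ⟨(b : G) ^ (orderOf (b : G) / p), pow_mem b.2 _, pow_mem hbc _, ?_⟩
  exact orderOf_pow_orderOf_div (orderOf_pos _).ne' hd

open scoped commutatorElement

theorem exists_geom_sum_eq_prime_mul {p : ℕ} (hp : p.Prime) {u : ℤ} (hu : (p : ℤ) ∣ u - 1)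
    (hu4 : p = 2 → (4 : ℤ) ∣ u - 1) :
    ∃ s : ℤ, ∑ i ∈ Finset.range p, u ^ i = p * s ∧ ¬ (p : ℤ) ∣ s := by
  rcases hp.eq_two_or_odd' with rfl | hodd
  · obtain ⟨c, hc⟩ := hu4 rfl
    refine ⟨2 * c + 1, ?_, by push_cast; omega⟩
    simp only [Finset.sum_range_succ, Finset.sum_range_zero]
    push_cast
    linarith
  · have hpu : ¬ (p : ℤ) ∣ u := fun h ↦
      (Nat.prime_iff_prime_int.mp hp).not_isUnit (isUnit_of_dvd_one ((dvd_sub_right h).mp hu))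
    have h := emultiplicity_geom_sum₂_eq_one (Nat.prime_iff_prime_int.mp hp) hodd hu hpu
    simp only [one_pow, mul_one] at h
    rw [← Nat.cast_one, emultiplicity_eq_coe] at h
    obtain ⟨⟨s, hs⟩, h2⟩ := h
    rw [pow_one] at hs
    refine ⟨s, hs, fun ⟨t, ht⟩ ↦ h2 ⟨t, by rw [hs, ht]; ring⟩⟩

theorem mul_pow_of_conj_eq_zpow {G : Type*} [Group G] {b x : G} {u : ℤ}
    (h : x * b * x⁻¹ = b ^ u) (n : ℕ) :
    (b * x) ^ n = b ^ (∑ i ∈ Finset.range n, u ^ i) * x ^ n := by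
  induction n with
  | zero => simp
  | succ n ih =>
    have h1 : x * b ^ (∑ i ∈ Finset.range n, u ^ i) =
        b ^ (u * ∑ i ∈ Finset.range n, u ^ i) * x := by
      rw [zpow_mul, ← h, conj_zpow]
      group
    rw [pow_succ', ih, geom_sum_succ, add_comm, zpow_add, zpow_one, pow_succ' x, mul_assoc b x,
      ← mul_assoc x, h1]
    simp only [mul_assoc]

theorem IsPGroup.exists_zpow_mul_eq {G : Type*} [Group G] [Finite G] {p : ℕ} [hp : Fact p.Prime]
    (hG : IsPGroup p G) {s : ℤ} (hs : ¬ (p : ℤ) ∣ s) (b : G) : ∃ t : ℤ, b ^ (t * s) = b := by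
  obtain ⟨k, hk⟩ := IsPGroup.iff_orderOf.mp hG b
  have hc : IsCoprime (p ^ k : ℤ) s :=
    ((Nat.prime_iff_prime_int.mp hp.out).coprime_iff_not_dvd.mpr hs).pow_left
  obtain ⟨v, t, hvt⟩ := hc
  refine ⟨t, ?_⟩
  have : t * s = 1 - v * (orderOf b : ℤ) := by rw [hk]; push_cast; linarith
  rw [this, zpow_sub, mul_comm v, zpow_mul, zpow_natCast, pow_orderOf_eq_one]
  simp

theorem mem_zpowers_of_pow_prime_eq_one {G : Type*} [Group G] [Finite G] {p : ℕ} (hp : p.Prime)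
    {A : Subgroup G} [IsCyclic A] {z b : G} (hz : z ∈ A) (hzp : orderOf z = p) (hb : b ∈ A)
    (hbp : b ^ p = 1) : b ∈ Subgroup.zpowers z := by
  classical
  have := Fintype.ofFinite A
  let z' : A := ⟨z, hz⟩
  have hz' : Nat.card (Subgroup.zpowers z') = p := by
    rw [Nat.card_zpowers, Subgroup.orderOf_mk, hzp]
  have hsub : (Finset.univ.filter fun a : A ↦ a ∈ Subgroup.zpowers z') ⊆
      Finset.univ.filter fun a : A ↦ a ^ p = 1 := by
    intro a ha
    simp only [Finset.mem_filter, Finset.mem_univ, true_and] at ha ⊢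
    obtain ⟨k, rfl⟩ := ha
    have : z' ^ p = 1 := by rw [← hzp, ← Subgroup.orderOf_mk z hz, pow_orderOf_eq_one]
    dsimp only
    rw [← zpow_natCast, zpow_comm, zpow_natCast, this, one_zpow]
  have heq := Finset.eq_of_subset_of_card_le hsub (by
    refine (IsCyclic.card_pow_eq_one_le hp.pos).trans ?_
    rw [← Fintype.card_subtype, ← Nat.card_eq_fintype_card]
    exact hz'.ge)
  have hmem : (⟨b, hb⟩ : A) ∈ Finset.univ.filter fun a : A ↦ a ^ p = 1 := by
    simpa [Subtype.ext_iff] using hbp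
  rw [← heq] at hmem
  obtain ⟨k, hk⟩ := (Finset.mem_filter.mp hmem).2
  exact ⟨k, congrArg Subtype.val hk⟩

/-- A normal elementary abelian subgroup of order `p ^ 2` containing the central element `z` of
order `p`, on which the whole group acts trivially modulo `⟨z⟩`. -/
structure IsNormalPlane {G : Type*} [Group G] (p : ℕ) (R : Subgroup G) (z : G) : Prop where
  normal : R.Normal
  card_eq : Nat.card R = p ^ 2
  pow_eq_one : ∀ r ∈ R, r ^ p = 1
  mem : z ∈ R
  mem_center : z ∈ Subgroup.center G
  orderOf_eq : orderOf z = p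
  commutator_mem : ∀ g : G, ∀ r ∈ R, ⁅g, r⁆ ∈ Subgroup.zpowers z

theorem isNormalPlane_sup {G : Type*} [Group G] {p : ℕ} [hp : Fact p.Prime] {y z : G}
    (hz : z ∈ Subgroup.center G) (hzp : orderOf z = p) (hy : y ∉ Subgroup.zpowers z)
    (hyp : y ^ p = 1) (hyz : ∀ g : G, ⁅g, y⁆ ∈ Subgroup.zpowers z) :
    IsNormalPlane p (Subgroup.zpowers z ⊔ Subgroup.zpowers y) z := by
  have hcz : ∀ g, Commute g z := fun g ↦ Subgroup.mem_center_iff.mp hz g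
  have hle : Subgroup.zpowers z ≤ Subgroup.center G := Subgroup.zpowers_le.mpr hz
  have hN : (Subgroup.zpowers z).Normal := by
    refine ⟨fun n hn g ↦ ?_⟩
    rwa [Subgroup.mem_center_iff.mp (hle hn), mul_inv_cancel_right]
  have hmem : ∀ r ∈ Subgroup.zpowers z ⊔ Subgroup.zpowers y, ∃ i j : ℤ, r = z ^ i * y ^ j := by
    intro r hr
    obtain ⟨_, ⟨i, rfl⟩, _, ⟨j, rfl⟩, rfl⟩ := Subgroup.mem_sup_of_normal_left.mp hr
    exact ⟨i, j, rfl⟩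
  have hzpow : z ^ p = 1 := hzp ▸ pow_orderOf_eq_one z
  have hcomm : ∀ g : G, ∀ r ∈ Subgroup.zpowers z ⊔ Subgroup.zpowers y,
      ⁅g, r⁆ ∈ Subgroup.zpowers z := by
    intro g r hr
    obtain ⟨i, j, rfl⟩ := hmem r hr
    have hd := Subgroup.mem_center_iff.mp (hle (hyz g))
    have h1 : g * y * g⁻¹ = ⁅g, y⁆ * y := by simp [commutatorElement_def]
    have h2 : ⁅g, z ^ i * y ^ j⁆ = ⁅g, y⁆ ^ j := by
      have h3 : g * (z ^ i * y ^ j) * g⁻¹ = z ^ i * (⁅g, y⁆ ^ j * y ^ j) := by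
        rw [← mul_assoc, ((hcz g).zpow_right i).eq, mul_assoc, mul_assoc, ← mul_assoc g,
          ← conj_zpow, h1, (show Commute ⁅g, y⁆ y from (hd y).symm).mul_zpow]
      rw [commutatorElement_def, h3, mul_inv_rev]
      have h4 : Commute (z ^ i) (⁅g, y⁆ ^ j) := ((hcz _).symm).zpow_zpow i j
      rw [h4.left_comm, mul_assoc, mul_assoc, mul_inv_cancel_left]
      rw [mul_inv_cancel, mul_one]
    rw [h2]
    exact Subgroup.zpow_mem _ (hyz g) j
  have hy1 : y ≠ 1 := fun h ↦ hy (h ▸ one_mem _)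
  have hyo : orderOf y = p := orderOf_eq_prime hyp hy1
  refine ⟨⟨fun r hr g ↦ ?_⟩, ?_, fun r hr ↦ ?_, ?_, hz, hzp, hcomm⟩
  · have : g * r * g⁻¹ = ⁅g, r⁆ * r := by simp [commutatorElement_def]
    rw [this]
    exact mul_mem ((le_sup_left : Subgroup.zpowers z ≤ _) (hcomm g r hr)) hr
  · have hc : ∀ (m : Subgroup.zpowers z) (n : Subgroup.zpowers y),
        Commute ((Subgroup.zpowers z).subtype m) ((Subgroup.zpowers y).subtype n) := fun m n ↦
      (Subgroup.mem_center_iff.mp (hle m.2) n).symm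
    have hinj : Function.Injective (MonoidHom.noncommCoprod _ _ hc) := by
      rw [MonoidHom.noncommCoprod_injective]
      refine ⟨Subtype.val_injective, Subtype.val_injective, ?_⟩
      rw [Subgroup.range_subtype, Subgroup.range_subtype, disjoint_comm]
      have hpr : (Nat.card (Subgroup.zpowers y)).Prime := by
        rw [Nat.card_zpowers, hyo]; exact hp.out
      have : Fact (Nat.card (Subgroup.zpowers y)).Prime := ⟨hpr⟩
      have h := Subgroup.eq_bot_or_eq_top_of_prime_card
        ((Subgroup.zpowers z).subgroupOf (Subgroup.zpowers y))
      rw [Subgroup.subgroupOf_eq_bot, Subgroup.subgroupOf_eq_top] at h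
      rcases h with h | h
      · exact h.symm
      · exact (hy (h (Subgroup.mem_zpowers y))).elim
    have hr := MonoidHom.noncommCoprod_range _ _ hc
    rw [Subgroup.range_subtype, Subgroup.range_subtype] at hr
    rw [← hr, ← Nat.card_congr (MonoidHom.ofInjective hinj).toEquiv, Nat.card_prod,
      Nat.card_zpowers, Nat.card_zpowers, hzp, hyo, sq]
  · obtain ⟨i, j, rfl⟩ := hmem r hr
    have h1 : Commute (z ^ i) (y ^ j) := ((hcz y).symm).zpow_zpow i j
    rw [h1.mul_pow, ← zpow_natCast, ← zpow_natCast, zpow_comm, zpow_comm y, zpow_natCast,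
      zpow_natCast, hzpow, hyp, one_zpow, one_zpow, one_mul]
  · exact (le_sup_left : Subgroup.zpowers z ≤ _) (Subgroup.mem_zpowers z)

theorem exists_isNormalPlane {G : Type*} [Group G] [Finite G] {p : ℕ} [hp : Fact p.Prime]
    (hG : IsPGroup p G) {z : G} (hz : z ∈ Subgroup.center G) (hzp : orderOf z = p)
    {A : Subgroup G} (hA : Maximal (fun A : Subgroup G ↦ A.Normal ∧ IsCyclic A) A) (hzA : z ∈ A)
    {x : G} (hxA : x ∉ A) (hcomm : ∀ g : G, ⁅g, x⁆ ∈ A) (hxp : x ^ p ∈ A) {u : ℤ}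
    (hu : (p : ℤ) ∣ u - 1) (hu4 : p = 2 → (4 : ℤ) ∣ u - 1)
    (hxu : ∀ b ∈ A, x * b * x⁻¹ = b ^ u) :
    ∃ R : Subgroup G, IsNormalPlane p R z := by
  obtain ⟨hAn, hAc⟩ := hA.prop
  obtain ⟨a, ha⟩ := (Subgroup.isCyclic_iff_exists_zpowers_eq_top A).mp hAc
  have haA : a ∈ A := ha ▸ Subgroup.mem_zpowers a
  have hAcomm : ∀ b ∈ A, ∀ c ∈ A, b * c = c * b := by
    rw [← ha]
    rintro _ ⟨i, rfl⟩ _ ⟨j, rfl⟩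
    exact zpow_mul_comm a i j
  obtain ⟨c, hcA, hc⟩ : ∃ c ∈ A, x ^ p = c ^ p := by
    obtain ⟨t, ht⟩ : ∃ t : ℤ, a ^ t = x ^ p := by rwa [← ha] at hxp
    by_cases hpt : (p : ℤ) ∣ t
    · obtain ⟨v, rfl⟩ := hpt
      exact ⟨a ^ v, zpow_mem haA v, by rw [← ht, mul_comm, zpow_mul, zpow_natCast]⟩
    · exfalso
      obtain ⟨v, hv⟩ := hG.exists_zpow_mul_eq hpt a
      have hax : A ≤ Subgroup.zpowers x := by
        rw [← ha, Subgroup.zpowers_le, ← hv, mul_comm, zpow_mul, ht]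
        exact zpow_mem (pow_mem (Subgroup.mem_zpowers x) p) v
      have hxN : (Subgroup.zpowers x).Normal := by
        refine ⟨fun n hn g ↦ ?_⟩
        obtain ⟨j, rfl⟩ := hn
        dsimp only
        rw [← conj_zpow]
        refine zpow_mem ?_ j
        have : g * x * g⁻¹ = ⁅g, x⁆ * x := by simp [commutatorElement_def]
        rw [this]
        exact mul_mem (hax (hcomm g)) (Subgroup.mem_zpowers x)
      exact hxA (hA.le_of_ge ⟨hxN, inferInstance⟩ hax (Subgroup.mem_zpowers x))
  obtain ⟨s, hs, hps⟩ := exists_geom_sum_eq_prime_mul hp.out hu hu4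
  obtain ⟨t, ht⟩ := hG.exists_zpow_mul_eq hps c⁻¹
  have hbA : c⁻¹ ^ t ∈ A := zpow_mem (inv_mem hcA) t
  set b := c⁻¹ ^ t with hb
  have hyA : b * x ∉ A := fun h ↦ hxA ((Subgroup.mul_mem_cancel_left A hbA).mp h)
  have hyp : (b * x) ^ p = 1 := by
    rw [mul_pow_of_conj_eq_zpow (hxu b hbA), hs, mul_comm (p : ℤ), hc, hb, ← zpow_mul, ← mul_assoc,
      zpow_mul, ht, zpow_natCast, inv_pow, inv_mul_cancel]
  have hyu : ∀ d ∈ A, (b * x) * d * (b * x)⁻¹ = d ^ u := by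
    intro d hd
    have h1 : (b * x) * d * (b * x)⁻¹ = b * (x * d * x⁻¹) * b⁻¹ := by group
    rw [h1, hxu d hd, hAcomm b hbA _ (zpow_mem hd u), mul_inv_cancel_right]
  have hyc : ∀ g : G, ⁅g, b * x⁆ ∈ A := by
    intro g
    have h1 : ⁅g, b * x⁆ = (g * b * g⁻¹) * ⁅g, x⁆ * b⁻¹ := by
      simp only [commutatorElement_def]; group
    rw [h1]
    exact mul_mem (mul_mem (hAn.conj_mem b hbA g) (hcomm g)) (inv_mem hbA)
  have hzA' : Subgroup.zpowers z ≤ A := Subgroup.zpowers_le.mpr hzA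
  refine ⟨_, isNormalPlane_sup hz hzp (fun h ↦ hyA (hzA' h)) hyp fun g ↦ ?_⟩
  refine mem_zpowers_of_pow_prime_eq_one hp.out hzA hzp (hyc g) ?_
  have h1 : (⁅g, b * x⁆ * (b * x)) ^ p = 1 := by
    have : ⁅g, b * x⁆ * (b * x) = g * (b * x) * g⁻¹ := by
      rw [commutatorElement_def, inv_mul_cancel_right]
    rw [this, conj_pow, hyp, mul_one, mul_inv_cancel]
  rw [mul_pow_of_conj_eq_zpow (hyu _ (hyc g)), hyp, mul_one, hs, zpow_mul, zpow_natCast] at h1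
  obtain ⟨v, hv⟩ := hG.exists_zpow_mul_eq hps (⁅g, b * x⁆ ^ p)
  rw [← hv, mul_comm, zpow_mul, h1, one_zpow]

theorem IsPGroup.nilpotencyClass_le_pred {G : Type*} [Group G] [Group.IsNilpotent G] {p : ℕ}
    [hp : Fact p.Prime] {n : ℕ} (hn : 2 ≤ n) (hG : Nat.card G = p ^ n) :
    Group.nilpotencyClass G ≤ n - 1 := by
  induction n using Nat.strong_induction_on generalizing G with
  | _ n ih =>
    have : Finite G := Nat.finite_of_card_ne_zero (hG ▸ (pow_pos hp.out.pos n).ne')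
    rcases hn.eq_or_lt with rfl | hn3
    · exact Group.IsNilpotent.nilpotencyClass_le_one_iff.mpr
        (IsPGroup.isMulCommutative_of_card_eq_prime_sq hG)
    · have hGp : IsPGroup p G := IsPGroup.of_card hG
      have : Nontrivial G := hGp.nontrivial_iff_card.mpr ⟨n, by omega, hG⟩
      rw [Group.nilpotencyClass_eq_quotient_center_plus_one]
      obtain ⟨m, hm⟩ := IsPGroup.iff_card.mp (hGp.to_quotient (Subgroup.center G))
      have hmn : m < n := by
        have := Subgroup.card_eq_card_quotient_mul_card_subgroup (Subgroup.center G)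
        have hc : 1 < Nat.card (Subgroup.center G) := by
          rw [Subgroup.one_lt_card_iff_ne_bot]
          exact hGp.bot_lt_center.ne'
        rw [hG, hm] at this
        refine (Nat.pow_lt_pow_iff_right hp.out.one_lt).mp ?_
        rw [this]
        exact lt_mul_of_one_lt_right (pow_pos hp.out.pos m) hc
      by_cases hm2 : 2 ≤ m
      · have := ih m hmn hm2 hm
        omega
      · have hq : Nat.card (G ⧸ Subgroup.center G) ∣ p := by
          rw [hm]
          interval_cases m <;> simp
        have hcyc : IsCyclic (G ⧸ Subgroup.center G) := isCyclic_of_card_dvd_prime hq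
        have := Group.IsNilpotent.nilpotencyClass_le_one_iff.mpr
          (inferInstance : IsMulCommutative (G ⧸ Subgroup.center G))
        omega

theorem nilpotencyClass_eq_of_index_two {G : Type*} [Group G] [Group.IsNilpotent G] {n : ℕ}
    (hG : Nat.card G = 2 ^ n) {a g : G} (ha : a ≠ 1) (hidx : (Subgroup.zpowers a).index = 2) {u : ℤ}
    (hu : (4 : ℤ) ∣ u + 1) (hg : g * a * g⁻¹ = a ^ u) :
    Group.nilpotencyClass G = n - 1 := by
  have hcard := (Subgroup.zpowers a).card_mul_index
  rw [Nat.card_zpowers, hidx, hG] at hcard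
  obtain ⟨m, rfl⟩ : ∃ m, n = m + 2 := by
    have h1 : orderOf a ≠ 1 := fun h ↦ ha (orderOf_eq_one_iff.mp h)
    rcases n with _ | _ | m
    · omega
    · omega
    · exact ⟨m, rfl⟩
  have hao : orderOf a = 2 ^ (m + 1) := by
    rw [pow_succ] at hcard
    exact Nat.eq_of_mul_eq_mul_right two_pos hcard
  refine le_antisymm (IsPGroup.nilpotencyClass_le_pred (p := 2) (by omega) hG) ?_
  by_contra! hlt
  have hmem : ∀ j, a ^ ((1 - u) ^ j) ∈ (⊤ : Subgroup G).lowerCentralSeries j := by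
    intro j
    induction j with
    | zero => simp
    | succ j ih =>
      have h1 := Subgroup.commutator_mem_commutator ih (Subgroup.mem_top g)
      rw [← Subgroup.lowerCentralSeries_succ] at h1
      convert h1 using 1
      have h2 : ⁅a ^ ((1 - u) ^ j), g⁆ =
          a ^ ((1 - u) ^ j) * (g * a ^ ((1 - u) ^ j) * g⁻¹)⁻¹ := by
        simp only [commutatorElement_def]; group
      rw [h2, ← conj_zpow, hg, ← zpow_mul, ← zpow_neg, ← zpow_add]
      congr 1
      ring
  have hbot := (Subgroup.lowerCentralSeries_eq_bot_iff_nilpotencyClass_le (G := G) (n := m)).mpr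
    (by omega)
  have h1 := hmem m
  rw [hbot, Subgroup.mem_bot, ← orderOf_dvd_iff_zpow_eq_one, hao] at h1
  obtain ⟨c, hc⟩ := hu
  have h2 : 1 - u = 2 * (1 - 2 * c) := by linarith
  rw [h2, mul_pow] at h1
  push_cast at h1
  rw [pow_succ] at h1
  have h3 := Int.prime_two.dvd_of_dvd_pow (Int.dvd_of_mul_dvd_mul_left (pow_ne_zero m two_ne_zero) h1)
  omega

theorem exists_isNormalPlane_or_nilpotencyClass_eq {G : Type*} [Group G] [Finite G]
    [Group.IsNilpotent G] {p : ℕ} [hp : Fact p.Prime] (hG : IsPGroup p G) (hnc : ¬ IsCyclic G) :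
    (∃ (R : Subgroup G) (z : G), IsNormalPlane p R z) ∨
      p = 2 ∧ ∀ n, Nat.card G = 2 ^ n → Group.nilpotencyClass G = n - 1 := by
  have hnt : Nontrivial G := by
    by_contra h
    rw [not_nontrivial_iff_subsingleton] at h
    exact hnc inferInstance
  obtain ⟨z, -, hz, hzp⟩ := exists_mem_center_orderOf_eq hG (S := ⊤) top_ne_bot
  have hzN : (Subgroup.zpowers z).Normal := by
    refine ⟨fun n hn g ↦ ?_⟩
    rwa [Subgroup.mem_center_iff.mp (Subgroup.zpowers_le.mpr hz hn), mul_inv_cancel_right]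
  obtain ⟨A, hzA, hA⟩ := Finite.exists_le_maximal
    (p := fun A : Subgroup G ↦ A.Normal ∧ IsCyclic A) (a := Subgroup.zpowers z)
    ⟨hzN, inferInstance⟩
  rw [Subgroup.zpowers_le] at hzA
  obtain ⟨hAn, hAc⟩ := hA.prop
  obtain ⟨a, ha⟩ := (Subgroup.isCyclic_iff_exists_zpowers_eq_top A).mp hAc
  have haA : a ∈ A := ha ▸ Subgroup.mem_zpowers a
  let M : Submonoid G :=
    { carrier := {g | ∃ u : ℤ, (p : ℤ) ∣ u - 1 ∧ (p = 2 → (4 : ℤ) ∣ u - 1) ∧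
        ∀ b ∈ A, g * b * g⁻¹ = b ^ u}
      one_mem' := ⟨1, by simp, by simp, by simp⟩
      mul_mem' := by
        rintro g h ⟨u, hu, hu4, hgu⟩ ⟨v, hv, hv4, hhv⟩
        have huv : u * v - 1 = u * (v - 1) + (u - 1) := by ring
        refine ⟨u * v, huv ▸ dvd_add (dvd_mul_of_dvd_right hv u) hu,
          fun h2 ↦ huv ▸ dvd_add (dvd_mul_of_dvd_right (hv4 h2) u) (hu4 h2), fun b hb ↦ ?_⟩
        have : g * h * b * (g * h)⁻¹ = g * (h * b * h⁻¹) * g⁻¹ := by group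
        rw [this, hhv b hb, hgu _ (zpow_mem hb v), ← zpow_mul, mul_comm] }
  let D : Subgroup G :=
    { M with
      inv_mem' := by
        intro g hg
        have : g⁻¹ = g ^ (orderOf g - 1) := by
          rw [inv_eq_iff_mul_eq_one, ← pow_succ', Nat.sub_add_cancel (orderOf_pos g),
            pow_orderOf_eq_one]
        have h2 : g⁻¹ ∈ M := this ▸ pow_mem (show g ∈ M from hg) _
        exact h2 }
  have hDn : D.Normal := by
    refine ⟨?_⟩
    rintro g ⟨u, hu, hu4, hgu⟩ h
    refine ⟨u, hu, hu4, fun b hb ↦ ?_⟩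
    have h1 : h * g * h⁻¹ * b * (h * g * h⁻¹)⁻¹ = h * (g * (h⁻¹ * b * h) * g⁻¹) * h⁻¹ := by group
    have h2 : h⁻¹ * b * h ∈ A := by simpa using hAn.conj_mem b hb h⁻¹
    rw [h1, hgu _ h2, ← conj_zpow]
    congr 1
    group
  by_cases hDA : D ≤ A
  swap
  · left
    have hS : D.map (QuotientGroup.mk' A) ≠ ⊥ := by
      rwa [Ne, Subgroup.map_eq_bot_iff, QuotientGroup.ker_mk']
    have : (D.map (QuotientGroup.mk' A)).Normal := hDn.map _ (QuotientGroup.mk'_surjective A)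
    obtain ⟨_, ⟨x, ⟨u, hu, hu4, hxu⟩, rfl⟩, hxc, hxo⟩ :=
      exists_mem_center_orderOf_eq (hG.to_quotient A) hS
    have hker : ∀ y : G, QuotientGroup.mk' A y = 1 ↔ y ∈ A := fun y ↦ by
      rw [← MonoidHom.mem_ker, QuotientGroup.ker_mk']
    obtain ⟨R, hR⟩ := exists_isNormalPlane hG hz hzp hA hzA (x := x)
      (fun h ↦ by
        rw [(hker x).mpr h, orderOf_one] at hxo
        exact hp.out.one_lt.ne hxo)
      (fun g ↦ by
        rw [← hker, map_commutatorElement, commutatorElement_eq_one_iff_mul_comm]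
        exact Subgroup.mem_center_iff.mp hxc _)
      (by rw [← hker, map_pow, ← hxo, pow_orderOf_eq_one])
      hu hu4 hxu
    exact ⟨R, z, hR⟩
  right
  have hact : ∀ g : G, ∃ u : ℤ, (p : ℤ) ∣ u - 1 ∧ ∀ b ∈ A, g * b * g⁻¹ = b ^ u := by
    intro g
    have h1 := hAn.conj_mem a haA g
    rw [← ha] at h1
    obtain ⟨u, hu⟩ := h1
    dsimp only at hu
    have h2 : ∀ b ∈ A, g * b * g⁻¹ = b ^ u := by
      rw [← ha]
      rintro _ ⟨j, rfl⟩
      dsimp only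
      rw [← conj_zpow, ← hu, zpow_comm]
    refine ⟨u, ?_, h2⟩
    rw [← hzp, orderOf_dvd_iff_zpow_eq_one, zpow_sub, ← h2 z hzA, zpow_one,
      Subgroup.mem_center_iff.mp hz g]
    group
  have hAtop : A ≠ ⊤ := by
    rintro rfl
    exact hnc (isCyclic_iff_exists_zpowers_eq_top.mpr ⟨a, ha⟩)
  obtain ⟨g, hgA⟩ : ∃ g, g ∉ A := by
    by_contra! h
    exact hAtop ((Subgroup.eq_top_iff' A).mpr h)
  obtain ⟨u, hu, hgu⟩ := hact g
  have hp2 : p = 2 := by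
    by_contra hp2
    exact hgA (hDA ⟨u, hu, fun h ↦ (hp2 h).elim, hgu⟩)
  subst hp2
  refine ⟨rfl, fun n hn ↦ ?_⟩
  have hu4 : ∀ h ∉ A, ∀ v : ℤ, ((2 : ℕ) : ℤ) ∣ v - 1 → (∀ b ∈ A, h * b * h⁻¹ = b ^ v) →
      (4 : ℤ) ∣ v + 1 := by
    intro h hh v hv hhv
    have : ¬ (4 : ℤ) ∣ v - 1 := fun h4 ↦ hh (hDA ⟨v, hv, fun _ ↦ h4, hhv⟩)
    push_cast at hv
    omega
  refine nilpotencyClass_eq_of_index_two hn (a := a) (g := g) ?_ ?_ (hu4 g hgA u hu hgu)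
    (hgu a haA)
  · rintro rfl
    rw [Subgroup.zpowers_one_eq_bot] at ha
    rw [← ha, Subgroup.mem_bot] at hzA
    rw [hzA, orderOf_one] at hzp
    omega
  · rw [ha, Subgroup.index_eq_two_iff]
    refine ⟨g, fun b ↦ ?_⟩
    by_cases hb : b ∈ A
    · exact Or.inr ⟨hb, fun h ↦ hgA ((Subgroup.mul_mem_cancel_left A hb).mp h)⟩
    · refine Or.inl ⟨hDA ?_, hb⟩
      obtain ⟨v, hv, hbv⟩ := hact b
      obtain ⟨c, hc⟩ := hu4 b hb v hv hbv
      obtain ⟨d, hd⟩ := hu4 g hgA u hu hgu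
      have huv : u * v - 1 = 4 * (4 * c * d - c - d) := by
        rw [eq_sub_of_add_eq hc, eq_sub_of_add_eq hd]; ring
      refine ⟨u * v, ?_, fun _ ↦ ⟨_, huv⟩, fun e he ↦ ?_⟩
      · rw [huv]; exact Dvd.dvd.mul_right (by norm_num) _
      · have : b * g * e * (b * g)⁻¹ = b * (g * e * g⁻¹) * b⁻¹ := by group
        rw [this, hgu e he, hbv _ (zpow_mem he u), ← zpow_mul]

theorem mul_pow_of_central_commutator {G : Type*} [Group G] {g r c : G} (hc : ∀ h, Commute c h)
    (h : r * g = g * r * c) (n : ℕ) : (g * r) ^ n = g ^ n * r ^ n * c ^ n.choose 2 := by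
  have hr : ∀ n : ℕ, r ^ n * g = g * r ^ n * c ^ n := by
    intro n
    induction n with
    | zero => simp
    | succ n ih =>
      rw [pow_succ', mul_assoc, ih, ← mul_assoc, ← mul_assoc, h, pow_succ' c, ← mul_assoc,
        mul_assoc (g * r) c, (hc _).eq]
      simp only [mul_assoc]
  induction n with
  | zero => simp
  | succ n ih =>
    rw [pow_succ, ih, Nat.choose_succ_succ' n 1, Nat.choose_one_right]
    calc g ^ n * r ^ n * c ^ n.choose 2 * (g * r)
        = g ^ n * (r ^ n * g) * r * c ^ n.choose 2 := by
          rw [mul_assoc _ (c ^ _), ((hc (g * r)).pow_left _).eq]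
          simp only [mul_assoc]
      _ = g ^ n * g * (r ^ n * (c ^ n * r)) * c ^ n.choose 2 := by
          rw [hr]
          simp only [mul_assoc]
      _ = g ^ (n + 1) * r ^ (n + 1) * c ^ (n + n.choose 2) := by
          rw [((hc r).pow_left n).eq, pow_succ g n, pow_succ r n, pow_add c]
          simp only [mul_assoc]

namespace IsNormalPlane

variable {G : Type*} [Group G] {p : ℕ} {R : Subgroup G} {z : G}

theorem commute_of_mem_zpowers (h : IsNormalPlane p R z) {c : G} (hc : c ∈ Subgroup.zpowers z)
    (g : G) : Commute c g :=
  (Subgroup.mem_center_iff.mp (Subgroup.zpowers_le.mpr h.mem_center hc) g).symm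

theorem zpowers_le (h : IsNormalPlane p R z) : Subgroup.zpowers z ≤ R :=
  Subgroup.zpowers_le.mpr h.mem

theorem exists_mul_eq (h : IsNormalPlane p R z) (g : G) {r : G} (hr : r ∈ R) :
    ∃ c ∈ Subgroup.zpowers z, r * g = g * r * c := by
  refine ⟨⁅r⁻¹, g⁻¹⁆, ?_, by simp only [commutatorElement_def]; group⟩
  rw [← commutatorElement_inv]
  exact inv_mem (h.commutator_mem g⁻¹ r⁻¹ (inv_mem hr))

theorem mul_pow_prime (h : IsNormalPlane p R z) (g : G) {r : G} (hr : r ∈ R) :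
    ∃ c ∈ Subgroup.zpowers z, r * g = g * r * c ∧ (g * r) ^ p = g ^ p * c ^ p.choose 2 := by
  obtain ⟨c, hc, hrg⟩ := h.exists_mul_eq g hr
  refine ⟨c, hc, hrg, ?_⟩
  rw [mul_pow_of_central_commutator (h.commute_of_mem_zpowers hc) hrg, h.pow_eq_one r hr, mul_one]

theorem mul_pow_prime_of_ne_two (h : IsNormalPlane p R z) (hp : p.Prime) (hp2 : p ≠ 2) (g : G)
    {r : G} (hr : r ∈ R) : (g * r) ^ p = g ^ p := by
  obtain ⟨c, hc, -, hgr⟩ := h.mul_pow_prime g hr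
  obtain ⟨k, hk⟩ : p ∣ p.choose 2 :=
    hp.dvd_choose_self two_ne_zero (lt_of_le_of_ne hp.two_le (Ne.symm hp2))
  rw [hgr, hk, pow_mul, h.pow_eq_one c (h.zpowers_le hc), one_pow, mul_one]

theorem mul_pow_prime_sq (h : IsNormalPlane p R z) (g : G) {r : G} (hr : r ∈ R) :
    (g * r) ^ p ^ 2 = g ^ p ^ 2 := by
  obtain ⟨c, hc, -, hgr⟩ := h.mul_pow_prime g hr
  rw [sq, pow_mul, hgr, ((h.commute_of_mem_zpowers hc _).symm.pow_right _).mul_pow, ← pow_mul,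
    ← pow_mul, mul_comm (p.choose 2), pow_mul c, h.pow_eq_one c (h.zpowers_le hc), one_pow, mul_one]

theorem mul_pow_prime_pow (h : IsNormalPlane p R z) (hp : p.Prime) {j : ℕ} (hj : 1 ≤ j)
    (hpj : p = 2 → 2 ≤ j) (g : G) {r : G} (hr : r ∈ R) : (g * r) ^ p ^ j = g ^ p ^ j := by
  by_cases hp2 : p = 2
  · obtain ⟨k, rfl⟩ := Nat.exists_eq_add_of_le (hpj hp2)
    rw [pow_add, pow_mul, h.mul_pow_prime_sq g hr, pow_mul]
  · obtain ⟨k, rfl⟩ := Nat.exists_eq_add_of_le hj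
    rw [pow_add, pow_one, pow_mul, h.mul_pow_prime_of_ne_two hp hp2 g hr, pow_mul]

theorem pow_dvd_ncard_orderOf_eq [Finite G] (h : IsNormalPlane p R z) (hp : p.Prime)
    (hG : IsPGroup p G) {i : ℕ} (hi : 2 ≤ i) (hpi : p = 2 → 3 ≤ i) :
    p ^ i ∣ {x : G | orderOf x = p ^ i}.ncard := by
  have : Fact p.Prime := ⟨hp⟩
  have := h.normal
  obtain ⟨j, rfl⟩ := Nat.exists_eq_add_of_le' hi
  have hord : ∀ x : G, orderOf x = p ^ (j + 2) ↔ x ^ p ^ (j + 1) ≠ 1 ∧ x ^ p ^ (j + 2) = 1 := by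
    refine fun x ↦ ⟨fun hx ↦ ⟨fun h1 ↦ ?_, hx ▸ pow_orderOf_eq_one x⟩,
      fun hx ↦ orderOf_eq_prime_pow hx.1 hx.2⟩
    have := (Nat.pow_dvd_pow_iff_le_right hp.one_lt).mp (hx ▸ orderOf_dvd_of_pow_eq_one h1)
    omega
  rw [ncard_eq_card_mul_ncard_image_mk R, h.card_eq]
  · suffices hY : p ^ j ∣ ((QuotientGroup.mk : G → G ⧸ R) ''
        {x : G | orderOf x = p ^ (j + 2)}).ncard by
      have hmul := mul_dvd_mul_left (p ^ 2) hY
      rwa [← pow_add, add_comm 2 j] at hmul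
    have hdvd : ∀ x : G, orderOf x = p ^ (j + 2) →
        ∃ e, orderOf (x : G ⧸ R) = p ^ (e + 1) ∧ j ≤ e := by
      intro x hx
      obtain ⟨e, he⟩ := IsPGroup.iff_orderOf.mp (hG.to_quotient R) (x : G ⧸ R)
      have hje : j < e := by
        by_contra! hej
        have h1 : (x : G ⧸ R) ^ p ^ j = 1 :=
          orderOf_dvd_iff_pow_eq_one.mp (he ▸ pow_dvd_pow p hej)
        rw [← QuotientGroup.mk_pow, QuotientGroup.eq_one_iff] at h1
        have h2 := h.pow_eq_one _ h1
        rw [← pow_mul, ← pow_succ] at h2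
        exact ((hord x).mp hx).1 h2
      exact ⟨e - 1, by rw [he]; congr 1; omega, by omega⟩
    refine dvd_ncard_of_dvd_totient_orderOf ?_ ?_
    · rintro _ ⟨x, hx, rfl⟩ y hy
      obtain ⟨e, he, -⟩ := hdvd x hx
      have hyx : y ∈ Submonoid.powers (x : G ⧸ R) :=
        mem_powers_iff_mem_zpowers.mpr (hy ▸ Subgroup.mem_zpowers y)
      obtain ⟨k, rfl⟩ := hyx
      have hk := mem_zpowers_pow_iff.mp (hy ▸ Subgroup.mem_zpowers (x : G ⧸ R))
      refine ⟨x ^ k, ?_, QuotientGroup.mk_pow R x k⟩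
      rw [Set.mem_ofPred_eq] at hx ⊢
      rw [Nat.Coprime.orderOf_pow, hx]
      rw [hx]
      rw [he] at hk
      exact (Nat.Coprime.pow_left _ (Nat.Coprime.coprime_dvd_left (dvd_pow_self p (by omega))
        (Nat.Coprime.symm hk)))
    · rintro _ ⟨x, hx, rfl⟩
      obtain ⟨e, he, hje⟩ := hdvd x hx
      rw [he, Nat.totient_prime_pow_succ hp]
      exact Dvd.dvd.mul_right (pow_dvd_pow p hje) _
  · intro x hx r hr
    rw [Set.mem_ofPred_eq, hord] at hx ⊢
    rwa [h.mul_pow_prime_pow hp (by omega) (fun h2 ↦ by have := hpi h2; omega) x hr,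
      h.mul_pow_prime_pow hp (by omega) (by omega) x hr]

end IsNormalPlane

namespace IsNormalPlane

variable {G : Type*} [Group G] {R : Subgroup G} {z : G}

theorem eq_one_or_eq_of_mem_zpowers (h : IsNormalPlane 2 R z) {c : G}
    (hc : c ∈ Subgroup.zpowers z) : c = 1 ∨ c = z := by
  obtain ⟨k, rfl⟩ := Subgroup.mem_zpowers_iff.mp hc
  have hz : z ^ (2 : ℤ) = 1 := by exact_mod_cast h.pow_eq_one z h.mem
  rcases Int.even_or_odd' k with ⟨m, rfl | rfl⟩
  · left
    rw [zpow_mul, hz, one_zpow]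
  · right
    rw [zpow_add, zpow_mul, hz, one_zpow, one_mul, zpow_one]

theorem ne_one (h : IsNormalPlane 2 R z) : z ≠ 1 := by
  rintro rfl
  simpa using h.orderOf_eq

theorem exists_mem_notMem_zpowers (h : IsNormalPlane 2 R z) : ∃ r ∈ R, r ∉ Subgroup.zpowers z := by
  by_contra! hR
  have hcard := h.card_eq
  rw [le_antisymm hR h.zpowers_le, Nat.card_zpowers, h.orderOf_eq] at hcard
  omega

theorem le_centralizer (h : IsNormalPlane 2 R z) : R ≤ Subgroup.centralizer (R : Set G) := by
  intro r hr
  rw [Subgroup.mem_centralizer_iff]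
  intro s hs
  have hsr := h.pow_eq_one _ (mul_mem hs hr)
  have hs2 := h.pow_eq_one s hs
  have hr2 := h.pow_eq_one r hr
  rw [sq, mul_eq_one_iff_eq_inv] at hsr hs2 hr2
  rw [hsr, mul_inv_rev, ← hs2, ← hr2]

theorem mem_centralizer_of_commute (h : IsNormalPlane 2 R z) {g r : G} (hr : r ∈ R)
    (hrz : r ∉ Subgroup.zpowers z) (hgr : Commute g r) : g ∈ Subgroup.centralizer (R : Set G) := by
  have hRfin : Finite R := Nat.finite_of_card_ne_zero (by rw [h.card_eq]; norm_num)
  set S : Subgroup G := Subgroup.centralizer {g} ⊓ R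
  have hzS : Subgroup.zpowers z ≤ S := le_inf (fun c hc ↦ Subgroup.mem_centralizer_singleton_iff.mpr
    (h.commute_of_mem_zpowers hc g).eq) h.zpowers_le
  have hrS : r ∈ S := ⟨Subgroup.mem_centralizer_singleton_iff.mpr hgr.eq.symm, hr⟩
  have hSR : S ≤ R := inf_le_right
  have hSfin : Finite S := Finite.of_injective _ (Subgroup.inclusion_injective hSR)
  have hdvd : Nat.card S ∣ 2 ^ 2 := h.card_eq ▸ Subgroup.card_dvd_of_le hSR
  have hlt : 2 < Nat.card S := by
    have hz2 : Nat.card (Subgroup.zpowers z) = 2 := by rw [Nat.card_zpowers, h.orderOf_eq]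
    by_contra! hle
    have heq := Subgroup.eq_of_le_of_card_ge hzS (by omega)
    exact hrz (heq ▸ hrS)
  have hcard : Nat.card S = 4 := by
    have := Nat.le_of_dvd (by norm_num) hdvd
    interval_cases hn : Nat.card S <;> omega
  have hSeq : S = R := Subgroup.eq_of_le_of_card_ge hSR (by rw [hcard, h.card_eq]; norm_num)
  rw [Subgroup.mem_centralizer_iff]
  intro s hs
  have hsS : s ∈ S := hSeq ▸ hs
  exact Subgroup.mem_centralizer_singleton_iff.mp hsS.1

theorem mul_sq_of_notMem_centralizer (h : IsNormalPlane 2 R z) {g r : G} (hr : r ∈ R)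
    (hrz : r ∉ Subgroup.zpowers z) (hg : g ∉ Subgroup.centralizer (R : Set G)) :
    (g * r) ^ 2 = g ^ 2 * z := by
  obtain ⟨c, hc, hrg, hsq⟩ := h.mul_pow_prime g hr
  rw [Nat.choose_self, pow_one] at hsq
  rcases h.eq_one_or_eq_of_mem_zpowers hc with rfl | rfl
  · exact absurd (h.mem_centralizer_of_commute hr hrz (by rw [mul_one] at hrg; exact hrg.symm)) hg
  · exact hsq

theorem mul_mem_centralizer (h : IsNormalPlane 2 R z) {g k : G}
    (hg : g ∉ Subgroup.centralizer (R : Set G)) (hk : k ∉ Subgroup.centralizer (R : Set G)) :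
    g * k ∈ Subgroup.centralizer (R : Set G) := by
  obtain ⟨r, hr, hrz⟩ := h.exists_mem_notMem_zpowers
  have key : ∀ x : G, x ∉ Subgroup.centralizer (R : Set G) → r * x = x * r * z := by
    intro x hx
    obtain ⟨c, hc, hrx⟩ := h.exists_mul_eq x hr
    rcases h.eq_one_or_eq_of_mem_zpowers hc with rfl | rfl
    · exact absurd (h.mem_centralizer_of_commute hr hrz (by rw [mul_one] at hrx; exact hrx.symm)) hx
    · exact hrx
  refine h.mem_centralizer_of_commute hr hrz (Eq.symm ?_)
  have hz : z * z = 1 := by rw [← sq]; exact h.pow_eq_one z h.mem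
  have hzk : Commute z k := h.commute_of_mem_zpowers (Subgroup.mem_zpowers z) k
  calc r * (g * k) = r * g * k := by rw [mul_assoc]
    _ = g * r * (z * k) := by rw [key g hg, mul_assoc _ z]
    _ = g * (r * k) * z := by rw [hzk.eq]; simp only [mul_assoc]
    _ = g * k * r := by rw [key k hk]; simp only [mul_assoc, hz, mul_one]

theorem centralizer_ne [Finite G] [Group.IsNilpotent G] (h : IsNormalPlane 2 R z)
    (hmc : ∀ n, Nat.card G = 2 ^ n → Group.nilpotencyClass G ≠ n - 1) {g : G}
    (hg : g ∉ Subgroup.centralizer (R : Set G)) : Subgroup.centralizer (R : Set G) ≠ R := by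
  intro hT
  have hidx : R.index = 2 := by
    rw [← hT]
    refine Subgroup.index_eq_two_iff.mpr ⟨g, fun b ↦ ?_⟩
    by_cases hb : b ∈ Subgroup.centralizer (R : Set G)
    · refine Or.inr ⟨hb, fun hbg ↦ hg ?_⟩
      exact (Subgroup.mul_mem_cancel_left _ hb).mp hbg
    · exact Or.inl ⟨h.mul_mem_centralizer hb hg, hb⟩
  have hcard : Nat.card G = 2 ^ 3 := by
    rw [← R.card_mul_index, hidx, h.card_eq]
    norm_num
  refine hmc 3 hcard (le_antisymm (IsPGroup.nilpotencyClass_le_pred (by norm_num) hcard) ?_)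
  by_contra! hlt
  have hcomm := Group.IsNilpotent.nilpotencyClass_le_one_iff.mp
    (by omega : Group.nilpotencyClass G ≤ 1)
  refine hg (Subgroup.mem_centralizer_iff.mpr fun s _ ↦ ?_)
  exact hcomm.is_comm.comm s g

theorem eight_dvd_ncard [Finite G] [Group.IsNilpotent G] (h : IsNormalPlane 2 R z)
    (hG : IsPGroup 2 G) (hmc : ∀ n, Nat.card G = 2 ^ n → Group.nilpotencyClass G ≠ n - 1) :
    8 ∣ {x : G | x ∉ Subgroup.centralizer (R : Set G) ∧ x ^ 2 ∈ R}.ncard := by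
  have := h.normal
  set T := Subgroup.centralizer (R : Set G)
  set F : Set G := {x : G | x ∉ T ∧ x ^ 2 ∈ R}
  rcases F.eq_empty_or_nonempty with hF0 | ⟨g, hg⟩
  · simp [hF0]
  have hFR : ∀ x ∈ F, ∀ r ∈ R, x * r ∈ F := by
    intro x hx r hr
    refine ⟨fun hxr ↦ hx.1 ((Subgroup.mul_mem_cancel_right _ (h.le_centralizer hr)).mp hxr), ?_⟩
    obtain ⟨c, hc, -, hsq⟩ := h.mul_pow_prime x hr
    rw [hsq]
    exact mul_mem hx.2 (pow_mem (h.zpowers_le hc) _)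
  rw [ncard_eq_card_mul_ncard_image_mk R hFR, h.card_eq]
  have hTR : T.map (QuotientGroup.mk' R) ≠ ⊥ := by
    rw [Ne, Subgroup.map_eq_bot_iff, QuotientGroup.ker_mk']
    exact fun hle ↦ h.centralizer_ne hmc hg.1 (le_antisymm hle h.le_centralizer)
  have : (T.map (QuotientGroup.mk' R)).Normal :=
    Subgroup.Normal.map inferInstance _ (QuotientGroup.mk'_surjective R)
  obtain ⟨_, ⟨t, ht, rfl⟩, hcen, hord⟩ := exists_mem_center_orderOf_eq (hG.to_quotient R) hTR
  suffices hY : 2 ∣ ((QuotientGroup.mk : G → G ⧸ R) '' F).ncard by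
    have := mul_dvd_mul_left (2 ^ 2) hY
    norm_num at this ⊢
    exact this
  rw [ncard_eq_card_mul_ncard_image_mk (Subgroup.zpowers (QuotientGroup.mk' R t)),
    Nat.card_zpowers, hord]
  · exact dvd_mul_right _ _
  rintro _ ⟨x, hx, rfl⟩ k hk
  obtain ⟨m, rfl⟩ := Subgroup.mem_zpowers_iff.mp hk
  have hcm : Commute (x : G ⧸ R) (QuotientGroup.mk' R t ^ m) :=
    Subgroup.mem_center_iff.mp (Subgroup.zpow_mem _ hcen m) x
  refine ⟨x * t ^ m, ⟨fun hxt ↦ hx.1 ((Subgroup.mul_mem_cancel_right _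
    (zpow_mem ht m)).mp hxt), ?_⟩, rfl⟩
  rw [← QuotientGroup.eq_one_iff, QuotientGroup.mk_pow]
  have hmk : ((x * t ^ m : G) : G ⧸ R) = x * QuotientGroup.mk' R t ^ m := rfl
  rw [hmk, hcm.mul_pow, ← QuotientGroup.mk_pow, (QuotientGroup.eq_one_iff _).mpr hx.2, one_mul,
    ← zpow_natCast, ← zpow_mul, mul_comm, zpow_mul, zpow_natCast, ← hord, pow_orderOf_eq_one,
    one_zpow]

theorem four_dvd_ncard_orderOf_eq [Finite G] [Group.IsNilpotent G] (h : IsNormalPlane 2 R z)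
    (hG : IsPGroup 2 G) (hmc : ∀ n, Nat.card G = 2 ^ n → Group.nilpotencyClass G ≠ n - 1) :
    4 ∣ {x : G | orderOf x = 4}.ncard := by
  have hord : ∀ x : G, orderOf x = 4 ↔ x ^ 2 ≠ 1 ∧ x ^ 4 = 1 := by
    refine fun x ↦ ⟨fun hx ↦ ⟨fun h1 ↦ ?_, hx ▸ pow_orderOf_eq_one x⟩,
      fun hx ↦ orderOf_eq_prime_pow (p := 2) (n := 1) hx.1 hx.2⟩
    have := Nat.le_of_dvd two_pos (orderOf_dvd_of_pow_eq_one h1)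
    omega
  have hF8 := h.eight_dvd_ncard hG hmc
  set T := Subgroup.centralizer (R : Set G)
  set F : Set G := {x : G | x ∉ T ∧ x ^ 2 ∈ R}
  set X : Set G := {x : G | orderOf x = 4} with hX
  have hunion : (X \ F).ncard + (X ∩ F).ncard = X.ncard := by
    rw [add_comm]
    exact Set.ncard_inter_add_ncard_sdiff_eq_ncard X F
  have h1 : 4 ∣ (X \ F).ncard := by
    rw [ncard_eq_card_mul_ncard_image_mk R, h.card_eq]
    · exact dvd_mul_right _ _
    rintro x ⟨hx, hxF⟩ r hr
    obtain ⟨c, hc, -, hsq⟩ := h.mul_pow_prime x hr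
    have h4 : (x * r) ^ 4 = x ^ 4 := h.mul_pow_prime_sq x hr
    have hxR : (x * r) ^ 2 ∈ R ↔ x ^ 2 ∈ R := by
      rw [hsq, Subgroup.mul_mem_cancel_right _ (pow_mem (h.zpowers_le hc) _)]
    have hxT : x * r ∈ T ↔ x ∈ T := Subgroup.mul_mem_cancel_right _ (h.le_centralizer hr)
    have hx' := (hord x).mp hx
    refine ⟨(hord _).mpr ⟨fun h2 ↦ ?_, h4 ▸ hx'.2⟩, fun hxr ↦ hxF
      ⟨fun hxt ↦ hxr.1 (hxT.mpr hxt), hxR.mp hxr.2⟩⟩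
    have hxt : x ∈ T := by
      by_contra hxt
      exact hxF ⟨hxt, hxR.mp (h2 ▸ one_mem R)⟩
    have hcomm : Commute x r := (Subgroup.mem_centralizer_iff.mp hxt r hr).symm
    rw [hcomm.mul_pow, h.pow_eq_one r hr, mul_one] at h2
    exact hx'.1 h2
  have h2 : 2 * (X ∩ F).ncard = F.ncard := by
    obtain ⟨r, hr, hrz⟩ := h.exists_mem_notMem_zpowers
    have hsq : ∀ x ∈ F, x ^ 2 = 1 ∨ x ^ 2 = z := by
      intro x hx
      refine h.eq_one_or_eq_of_mem_zpowers (by_contra fun hxz ↦ hx.1 ?_)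
      exact h.mem_centralizer_of_commute hx.2 hxz ((Commute.refl x).pow_right 2)
    have hzz : z * z = 1 := by rw [← sq]; exact h.pow_eq_one z h.mem
    have hXF : ∀ x ∈ F, x ∈ X ↔ x ^ 2 = z := by
      intro x hx
      rw [hX, Set.mem_ofPred_eq, hord]
      refine ⟨fun h' ↦ (hsq x hx).resolve_left h'.1, fun h' ↦ ⟨h' ▸ h.ne_one, ?_⟩⟩
      rw [show 4 = 2 * 2 from rfl, pow_mul, h', sq, hzz]
    have hmul : ∀ x ∈ F, x * r ∈ F ∧ (x * r) ^ 2 = x ^ 2 * z := by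
      intro x hx
      have hxr := h.mul_sq_of_notMem_centralizer hr hrz hx.1
      exact ⟨⟨fun h' ↦ hx.1 ((Subgroup.mul_mem_cancel_right _ (h.le_centralizer hr)).mp h'),
        hxr ▸ mul_mem hx.2 h.mem⟩, hxr⟩
    have hcongr : (X ∩ F).ncard = (F \ X).ncard := by
      refine Set.ncard_congr (fun x _ ↦ x * r) ?_ (fun a b _ _ hab ↦ mul_right_cancel hab) ?_
      · rintro x ⟨hx, hxF⟩
        refine ⟨(hmul x hxF).1, fun hxr ↦ ?_⟩
        rw [hXF _ (hmul x hxF).1, (hmul x hxF).2, (hXF x hxF).mp hx, hzz] at hxr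
        exact h.ne_one hxr.symm
      · rintro x ⟨hxF, hx⟩
        refine ⟨x * r, ⟨(hXF _ (hmul x hxF).1).mpr ?_, (hmul x hxF).1⟩, ?_⟩
        · rw [(hmul x hxF).2, (hsq x hxF).resolve_right (fun h' ↦ hx ((hXF x hxF).mpr h')), one_mul]
        · rw [mul_assoc, ← sq, h.pow_eq_one r hr, mul_one]
    have hFX := Set.ncard_inter_add_ncard_sdiff_eq_ncard F X
    rw [Set.inter_comm] at hFX
    omega
  omega

end IsNormalPlane

/-- Let p be a prime and let G be a finite non-cyclic p-group of exponent
p^k; if p = 2, assume moreover that G is not of maximal class (i.e., if |G| = 2ⁿ then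
the nilpotency class of G is not n − 1). Then for every i with 2 ≤ i ≤ k, p divides
the number of cyclic subgroups of G of order p^i.  (Note: every finite p-group is
nilpotent, so the instance `Group.IsNilpotent G` is automatic and only used to speak
of the nilpotency class.) -/
theorem num_cyclic_subgroups_order_p_pow_dvd (p : ℕ) (hp : p.Prime)
    {G : Type*} [Group G] [Finite G] [Group.IsNilpotent G]
    (hG : IsPGroup p G) (hnc : ¬ IsCyclic G) (k : ℕ)
    (hexp : Monoid.exponent G = p ^ k)
    (hmc : p = 2 → ∀ n : ℕ, Nat.card G = 2 ^ n → Group.nilpotencyClass G ≠ n - 1) :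
    ∀ i : ℕ, 2 ≤ i → i ≤ k →
      p ∣ Nat.card {H : Subgroup G // IsCyclic H ∧ Nat.card H = p ^ i} := by
  have : Fact p.Prime := ⟨hp⟩
  intro i hi _
  apply dvd_card_cyclic_of_pow_dvd_ncard hp (by omega)
  rcases exists_isNormalPlane_or_nilpotencyClass_eq hG hnc with ⟨R, z, h⟩ | ⟨hp2, hmax⟩
  · by_cases hpi : p = 2 ∧ i = 2
    · obtain ⟨rfl, rfl⟩ := hpi
      exact h.four_dvd_ncard_orderOf_eq hG (hmc rfl)
    · exact h.pow_dvd_ncard_orderOf_eq hp hG hi (by omega)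
  · obtain ⟨n, hn⟩ := IsPGroup.iff_card.mp hG
    subst hp2
    exact absurd (hmax n hn) (hmc rfl n hn)
end
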